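/- There exists a function B₅ : ℕ × ℕ → ℕ with the following property: for all d, ℓ ∈ ℕ and every polynomial f(x, y) ∈ ℂ[x, y] which is monic as a polynomial in y, which has at most ℓ nonzero coefficients when written as a polynomial in x over ℂ[y], and whose degree in y is at most d, if g ∈ ℂ(x) is a rational function satisfying f(x, g(x)) = 0 identically, then g is in fact a polynomial, g ∈ ℂ[x], and N(g) ≤ B₅(d, ℓ). -/

import Mathlib

open Polynomial

section AlgClosedCriterion

lemma coeff_comp_X_add_C_natDegree_sub_one {R : Type*} [CommRing R] [Nontrivial R] {p : R[X]}
    (hp : p.Monic) (h0 : 0 < p.natDegree) (c : R) :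
    (p.comp (X + C c)).coeff (p.natDegree - 1) = p.nextCoeff + p.natDegree * c := by
  obtain ⟨m, hm⟩ : ∃ m, p.natDegree = m + 1 := ⟨p.natDegree - 1, by omega⟩
  have hlow : (p.eraseLead.comp (X + C c)).coeff m = p.nextCoeff := by
    have hnext : p.nextCoeff = p.eraseLead.coeff m := by
      rw [nextCoeff_of_natDegree_pos h0, eraseLead_coeff_of_ne _ (by omega), hm,
        Nat.add_sub_cancel]
    have hle : p.eraseLead.natDegree ≤ m := (eraseLead_natDegree_le p).trans (by omega)
    rcases hle.lt_or_eq with h | h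
    · rw [hnext, coeff_eq_zero_of_natDegree_lt h]
      refine coeff_eq_zero_of_natDegree_lt (natDegree_comp_le.trans_lt ?_)
      rwa [natDegree_X_add_C, mul_one]
    · have := coeff_comp_degree_mul_degree (p := p.eraseLead) (q := X + C c)
        (by simp)
      rw [natDegree_X_add_C, mul_one, h, leadingCoeff_X_add_C, one_pow, mul_one, leadingCoeff,
        h] at this
      rw [this, hnext]
  have hsum : p.comp (X + C c) = p.eraseLead.comp (X + C c) + (X + C c) ^ (m + 1) := by
    conv_lhs => rw [← p.eraseLead_add_C_mul_X_pow]
    simp [hp.leadingCoeff, hm]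
  rw [hm, Nat.add_sub_cancel, hsum, coeff_add, hlow, coeff_X_add_C_pow]
  simp [mul_comm]

variable {k : Type*} [NontriviallyNormedField k] [CompleteSpace k] [IsUltrametricDist k]

lemma exists_spectralNorm_sub_lt {Ω : Type*} [Field Ω] [Algebra k Ω]
    [Algebra.IsAlgebraic k Ω]
    (hdiv : ∀ x : k, x ≠ 0 → ∀ n : ℕ, n ≠ 0 → ∃ m : k, ‖m‖ ^ n = ‖x‖)
    (hres : ∀ p : k[X], p.Monic → 0 < p.natDegree → (∀ i, ‖p.coeff i‖ ≤ 1) →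
      ∃ a : k, ‖a‖ ≤ 1 ∧ ‖p.eval a‖ < 1) (y : Ω) (hy : y ≠ 0) :
    ∃ c : k, spectralNorm k Ω (y - algebraMap k Ω c) < spectralNorm k Ω y := by
  have hinteg : ∀ x : Ω, IsIntegral k x := fun x => Algebra.IsIntegral.isIntegral x
  have hc0 : (minpoly k y).coeff 0 ≠ 0 := minpoly.coeff_zero_ne_zero (hinteg y) hy
  have hmul : ∀ a b : Ω, spectralNorm k Ω (a * b) = spectralNorm k Ω a * spectralNorm k Ω b :=
    fun a b => map_mul (spectralMulAlgNorm k Ω) a b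
  obtain ⟨m, hm⟩ := hdiv _ hc0 _ (minpoly.natDegree_pos (hinteg y)).ne'
  have hmy : spectralNorm k Ω y = ‖m‖ := by
    rw [spectralNorm.spectralNorm_eq_norm_coeff_zero_rpow, ← hm, one_div,
      Real.pow_rpow_inv_natCast (norm_nonneg _) (minpoly.natDegree_pos (hinteg y)).ne']
  have hypos : 0 < spectralNorm k Ω y := spectralNorm_zero_lt hy (hinteg y).isAlgebraic
  have hm0 : m ≠ 0 := by rw [hmy] at hypos; exact norm_pos_iff.mp hypos
  have hm0' : algebraMap k Ω m ≠ 0 := by simpa using hm0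
  set u : Ω := y / algebraMap k Ω m with hu
  have hyu : y = algebraMap k Ω m * u := by rw [hu]; field_simp
  have hu1 : spectralNorm k Ω u = 1 := by
    have := hmul (algebraMap k Ω m) u
    rw [← hyu, spectralNorm_extends, hmy] at this
    exact (mul_eq_left₀ (norm_ne_zero_iff.mpr hm0)).mp this.symm
  obtain ⟨a, ha, hpa⟩ := hres (minpoly k u) (minpoly.monic (hinteg u))
    (minpoly.natDegree_pos (hinteg u))
    ((spectralValue_le_one_iff (minpoly.monic (hinteg u))).mp hu1.le)
  refine ⟨m * a, ?_⟩
  have : y - algebraMap k Ω (m * a) = algebraMap k Ω m * (u - algebraMap k Ω a) := by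
    rw [hyu, map_mul]; ring
  rw [this, hmul, spectralNorm_extends, hmy]
  refine mul_lt_of_lt_one_right (hmy ▸ hypos) ?_
  rw [spectralNorm.spectralNorm_eq_norm_coeff_zero_rpow, minpoly.sub_algebraMap]
  have : ((minpoly k u).comp (X + C a)).coeff 0 = (minpoly k u).eval a := by
    rw [coeff_zero_eq_eval_zero, eval_comp]; simp
  rw [this]
  refine Real.rpow_lt_one (norm_nonneg _) hpa ?_
  have := minpoly.natDegree_pos (hinteg u)
  rw [natDegree_comp, natDegree_X_add_C, mul_one]
  positivity

/-- A complete ultrametric field of residue characteristic zero, whose value group is divisible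
and whose residue field is algebraically closed, is algebraically closed. -/
theorem isAlgClosed_of_residue_of_divisible [CharZero k] (hn : ∀ n : ℕ, n ≠ 0 → ‖(n : k)‖ = 1)
    (hdiv : ∀ x : k, x ≠ 0 → ∀ n : ℕ, n ≠ 0 → ∃ m : k, ‖m‖ ^ n = ‖x‖)
    (hres : ∀ p : k[X], p.Monic → 0 < p.natDegree → (∀ i, ‖p.coeff i‖ ≤ 1) →
      ∃ a : k, ‖a‖ ≤ 1 ∧ ‖p.eval a‖ < 1) : IsAlgClosed k := by
  let Ω := AlgebraicClosure k
  have hinteg : ∀ x : Ω, IsIntegral k x := fun x => Algebra.IsIntegral.isIntegral x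
  have key : ∀ y : Ω, (minpoly k y).nextCoeff = 0 → y = 0 := by
    intro y hy
    by_contra hy0
    obtain ⟨c, hc⟩ := exists_spectralNorm_sub_lt hdiv hres y hy0
    have hpos := minpoly.natDegree_pos (hinteg y)
    have hcn : ‖c‖ = spectralNorm k Ω y := by
      have h1 := (isNonarchimedean_spectralNorm (K := k) (L := Ω)) (y - algebraMap k Ω c)
        (algebraMap k Ω c)
      have h2 := (isNonarchimedean_spectralNorm (K := k) (L := Ω)) (-(y - algebraMap k Ω c)) y
      rw [spectralNorm_neg (hinteg _).isAlgebraic] at h2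
      rw [sub_add_cancel, spectralNorm_extends] at h1
      rw [show -(y - algebraMap k Ω c) + y = algebraMap k Ω c by ring, spectralNorm_extends] at h2
      rcases le_max_iff.mp h1 with h | h
      · exact absurd h (not_le.mpr hc)
      · rcases le_max_iff.mp h2 with h' | h'
        · exact le_antisymm (h'.trans hc.le) h
        · exact le_antisymm h' h
    have hle : ‖c‖ ≤ spectralNorm k Ω (y - algebraMap k Ω c) := by
      have h1 : spectralValueTerms (minpoly k (y - algebraMap k Ω c)) ((minpoly k y).natDegree - 1)
          = ‖c‖ := by
        rw [minpoly.sub_algebraMap, spectralValueTerms_of_lt_natDegree,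
          coeff_comp_X_add_C_natDegree_sub_one (minpoly.monic (hinteg y)) hpos, hy, zero_add,
          natDegree_comp, natDegree_X_add_C, mul_one, Nat.cast_sub hpos, norm_mul,
          hn _ hpos.ne']
        · simp
        · rw [natDegree_comp, natDegree_X_add_C]; omega
      rw [← h1]
      exact le_ciSup (spectralValueTerms_bddAbove _) _
    exact absurd (hle.trans_lt hc) (by simp [hcn])
  refine IsAlgClosed.of_exists_root _ fun p hp hirr => ?_
  obtain ⟨y, hy⟩ := IsAlgClosed.exists_aeval_eq_zero Ω p hirr.degree_pos.ne'
  have hpy := minpoly.eq_of_irreducible_of_monic hirr hy hp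
  have hpos := minpoly.natDegree_pos (hinteg y)
  set n := p.natDegree with hndef
  have hn0 : (n : k) ≠ 0 := by rw [hndef, hpy]; exact_mod_cast hpos.ne'
  refine ⟨-(p.nextCoeff / n), ?_⟩
  have : y - algebraMap k Ω (-(p.nextCoeff / n)) = 0 := by
    apply key
    have hmon := minpoly.monic (hinteg y)
    rw [nextCoeff_of_natDegree_pos (minpoly.natDegree_pos (hinteg _)), minpoly.sub_algebraMap,
      natDegree_comp, natDegree_X_add_C, mul_one,
      coeff_comp_X_add_C_natDegree_sub_one hmon hpos, ← hpy, ← hndef]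
    field_simp
    ring
  rw [sub_eq_zero.mp this] at hy
  rw [aeval_algebraMap_apply] at hy
  exact (map_eq_zero_iff _ (algebraMap k Ω).injective).mp hy

end AlgClosedCriterion

section NormedHahn

/-- A strictly monotone additive map to the real numbers. -/
class RealEmbedding (Γ : Type*) [AddCommGroup Γ] [LinearOrder Γ] where
  toReal : Γ →+ ℝ
  strictMono : StrictMono toReal

variable {Γ F : Type*} [AddCommGroup Γ] [LinearOrder Γ] [IsOrderedAddMonoid Γ] [RealEmbedding Γ]
  [Field F]

open RealEmbedding

open Classical in
/-- The absolute value `exp (-order)` on Hahn series. -/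
noncomputable def hahnAbs (Γ F : Type*) [AddCommGroup Γ] [LinearOrder Γ] [IsOrderedAddMonoid Γ]
    [RealEmbedding Γ] [Field F] : AbsoluteValue (HahnSeries Γ F) ℝ where
  toFun x := if x = 0 then 0 else Real.exp (-toReal x.order)
  map_mul' x y := by
    by_cases hx : x = 0
    · simp [hx]
    by_cases hy : y = 0
    · simp [hy]
    simp only [mul_eq_zero, hx, hy, or_self, if_false, HahnSeries.order_mul hx hy, map_add,
      ← Real.exp_add]
    congr 1; ring
  nonneg' x := by positivity
  eq_zero' x := by
    by_cases hx : x = 0 <;> simp [hx, Real.exp_ne_zero]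
  add_le' x y := by
    by_cases hx : x = 0
    · simp [hx]
    by_cases hy : y = 0
    · simp [hy]
    by_cases hxy : x + y = 0
    · simp only [hxy, if_true]; positivity
    simp only [hx, hy, hxy, if_false]
    have h := HahnSeries.min_order_le_order_add hxy
    have hp := Real.exp_pos
    rcases min_le_iff.mp h with h | h
    · have := strictMono.monotone h
      have := Real.exp_le_exp.mpr (neg_le_neg this)
      linarith [hp (-toReal y.order)]
    · have := strictMono.monotone h
      have := Real.exp_le_exp.mpr (neg_le_neg this)
      linarith [hp (-toReal x.order)]

noncomputable instance : NormedField (HahnSeries Γ F) := (hahnAbs Γ F).toNormedField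

lemma hahn_norm_of_ne_zero {x : HahnSeries Γ F} (hx : x ≠ 0) :
    ‖x‖ = Real.exp (-toReal x.order) := if_neg hx

lemma hahn_norm_single (γ : Γ) {a : F} (ha : a ≠ 0) :
    ‖HahnSeries.single γ a‖ = Real.exp (-toReal γ) := by
  rw [hahn_norm_of_ne_zero (HahnSeries.single_ne_zero ha), HahnSeries.order_single ha]

lemma hahn_norm_le_iff {x : HahnSeries Γ F} {γ : Γ} :
    ‖x‖ ≤ Real.exp (-toReal γ) ↔ ∀ g < γ, x.coeff g = 0 := by
  by_cases hx : x = 0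
  · simp [hx, Real.exp_nonneg]
  rw [hahn_norm_of_ne_zero hx, Real.exp_le_exp, neg_le_neg_iff, strictMono.le_iff_le]
  refine ⟨fun h g hg => HahnSeries.coeff_eq_zero_of_lt_order (hg.trans_le h), fun h => ?_⟩
  by_contra hlt
  exact hx (HahnSeries.coeff_order_eq_zero.mp (h _ (not_le.mp hlt)))

lemma hahn_norm_lt_iff {x : HahnSeries Γ F} {γ : Γ} :
    ‖x‖ < Real.exp (-toReal γ) ↔ ∀ g ≤ γ, x.coeff g = 0 := by
  by_cases hx : x = 0
  · simp [hx, Real.exp_pos]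
  rw [hahn_norm_of_ne_zero hx, Real.exp_lt_exp, neg_lt_neg_iff, strictMono.lt_iff_lt]
  refine ⟨fun h g hg => HahnSeries.coeff_eq_zero_of_lt_order (hg.trans_lt h), fun h => ?_⟩
  by_contra hlt
  exact hx (HahnSeries.coeff_order_eq_zero.mp (h _ (not_lt.mp hlt)))

instance : IsUltrametricDist (HahnSeries Γ F) := by
  refine IsUltrametricDist.isUltrametricDist_of_isNonarchimedean_norm fun x y => ?_
  by_cases hx : x = 0
  · simp [hx]
  by_cases hy : y = 0
  · simp [hy]
  rw [hahn_norm_of_ne_zero hx, hahn_norm_of_ne_zero hy, le_max_iff, hahn_norm_le_iff,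
    hahn_norm_le_iff]
  rcases le_total x.order y.order with h | h
  · left
    intro g hg
    rw [HahnSeries.coeff_add, HahnSeries.coeff_eq_zero_of_lt_order hg,
      HahnSeries.coeff_eq_zero_of_lt_order (hg.trans_le h), add_zero]
  · right
    intro g hg
    rw [HahnSeries.coeff_add, HahnSeries.coeff_eq_zero_of_lt_order hg,
      HahnSeries.coeff_eq_zero_of_lt_order (hg.trans_le h), add_zero]

lemma exists_toReal_gt [Nontrivial Γ] (M : ℝ) : ∃ γ : Γ, M < toReal γ := by
  obtain ⟨γ, hγ⟩ : ∃ γ : Γ, 0 < γ := exists_zero_lt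
  have h0 : 0 < toReal γ := by simpa using strictMono (Γ := Γ) hγ
  obtain ⟨n, hn⟩ := Archimedean.arch (M + 1) h0
  exact ⟨n • γ, by rw [map_nsmul]; linarith⟩

lemma exists_exp_toReal_lt [Nontrivial Γ] {ε : ℝ} (hε : 0 < ε) :
    ∃ γ : Γ, Real.exp (-toReal γ) < ε := by
  obtain ⟨γ, hγ⟩ := exists_toReal_gt (Γ := Γ) (-Real.log ε)
  refine ⟨γ, ?_⟩
  rw [← Real.lt_log_iff_exp_lt hε]
  linarith

instance [Nontrivial Γ] : CompleteSpace (HahnSeries Γ F) := by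
  refine Metric.complete_of_cauchySeq_tendsto fun u hu => ?_
  have hstab : ∀ γ : Γ, ∃ N, ∀ n ≥ N, ∀ g ≤ γ, (u n).coeff g = (u N).coeff g := by
    intro γ
    obtain ⟨N, hN⟩ := Metric.cauchySeq_iff'.mp hu _ (Real.exp_pos (-toReal γ))
    refine ⟨N, fun n hn g hg => ?_⟩
    have := hN n hn
    rw [dist_eq_norm, hahn_norm_lt_iff] at this
    exact sub_eq_zero.mp (by simpa using this g hg)
  choose N hN using hstab
  have hcoeff : ∀ γ, ∀ n ≥ N γ, ∀ g ≤ γ, (u n).coeff g = (u (N g)).coeff g := by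
    intro γ n hn g hg
    rw [hN γ n hn g hg, ← hN γ (max (N γ) (N g)) (le_max_left _ _) g hg,
      hN g (max (N γ) (N g)) (le_max_right _ _) g le_rfl]
  have hpwo : (Function.support fun g => (u (N g)).coeff g).IsPWO := by
    intro f
    by_cases h : ∃ m > 0, (f 0 : Γ) ≤ f m
    · obtain ⟨m, hm, h⟩ := h
      exact ⟨0, m, hm, h⟩
    push Not at h
    have hle : ∀ m, (f m : Γ) ≤ f 0 := fun m => by
      rcases Nat.eq_zero_or_pos m with rfl | hm
      · exact le_rfl
      · exact (h m hm).le
    obtain ⟨m, n, hmn, hh⟩ := (u (N (f 0))).isPWO_support fun i => ⟨f i, by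
      have := (f i).2
      rw [HahnSeries.mem_support, hcoeff _ _ le_rfl _ (hle i)]
      exact this⟩
    exact ⟨m, n, hmn, hh⟩
  refine ⟨⟨fun g => (u (N g)).coeff g, hpwo⟩, Metric.tendsto_atTop.mpr fun ε hε => ?_⟩
  obtain ⟨γ, hγ⟩ := exists_exp_toReal_lt (Γ := Γ) hε
  refine ⟨N γ, fun n hn => lt_of_le_of_lt ?_ hγ⟩
  rw [dist_eq_norm, hahn_norm_le_iff]
  intro g hg
  rw [HahnSeries.coeff_sub, hcoeff γ n hn g hg.le, sub_self]

lemma hahn_coeff_eval_C {Γ F : Type*} [AddCommGroup Γ] [LinearOrder Γ] [IsOrderedAddMonoid Γ]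
    [Field F] (p : (HahnSeries Γ F)[X]) (a : F) (g : Γ) :
    (p.eval (HahnSeries.C a)).coeff g =
      ∑ i ∈ Finset.range (p.natDegree + 1), (p.coeff i).coeff g * a ^ i := by
  rw [eval_eq_sum_range, HahnSeries.coeff_sum]
  refine Finset.sum_congr rfl fun i _ => ?_
  rw [← map_pow, mul_comm, HahnSeries.C_mul_eq_smul, HahnSeries.coeff_smul, smul_eq_mul, mul_comm]

theorem hahn_isAlgClosed_subfield [Nontrivial Γ] [IsAlgClosed F] [CharZero F]
    (hΓ : ∀ γ : Γ, ∀ n : ℕ, n ≠ 0 → ∃ γ', n • γ' = γ)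
    (S : Subfield (HahnSeries Γ F)) (hS : IsClosed (S : Set (HahnSeries Γ F)))
    (hmono : ∀ (γ : Γ) (a : F), HahnSeries.single γ a ∈ S) : IsAlgClosed S := by
  have hnat : ∀ n : ℕ, (n : HahnSeries Γ F) = HahnSeries.single 0 (n : F) := fun n =>
    (map_natCast (HahnSeries.C : F →+* HahnSeries Γ F) n).symm
  have hchar : CharZero S := by
    refine ⟨fun m n h => ?_⟩
    have h1 : ((m : S) : HahnSeries Γ F) = (n : S) := by rw [h]
    push_cast at h1
    rw [hnat, hnat] at h1
    exact Nat.cast_injective (HahnSeries.single_injective _ h1)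
  let _ : NontriviallyNormedField S :=
    { (inferInstance : NormedField S) with
      non_trivial := by
        obtain ⟨γ, hγ⟩ := exists_toReal_gt (Γ := Γ) 0
        refine ⟨⟨HahnSeries.single (-γ) 1, hmono _ _⟩, ?_⟩
        change 1 < ‖HahnSeries.single (-γ) (1 : F)‖
        rw [hahn_norm_single _ one_ne_zero, map_neg, neg_neg]
        exact Real.one_lt_exp_iff.mpr hγ }
  have : CompleteSpace S := hS.completeSpace_coe
  have : IsUltrametricDist S := ⟨fun x y z => dist_triangle_max (x : HahnSeries Γ F) y z⟩
  refine isAlgClosed_of_residue_of_divisible ?_ ?_ ?_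
  · intro n hn
    change ‖((n : S) : HahnSeries Γ F)‖ = 1
    push_cast
    rw [hnat, hahn_norm_single _ (Nat.cast_ne_zero.mpr hn)]
    simp
  · intro x hx n hn
    have hx' : (x : HahnSeries Γ F) ≠ 0 := by simpa using hx
    obtain ⟨γ, hγ⟩ := hΓ (x : HahnSeries Γ F).order n hn
    refine ⟨⟨HahnSeries.single γ 1, hmono _ _⟩, ?_⟩
    change ‖HahnSeries.single γ (1 : F)‖ ^ n = ‖(x : HahnSeries Γ F)‖
    rw [hahn_norm_single _ one_ne_zero, hahn_norm_of_ne_zero hx', ← Real.exp_nat_mul, ← hγ,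
      map_nsmul]
    simp
  · intro p hp hdeg hcoef
    have hcoef' : ∀ i, ∀ g < 0, (p.coeff i : HahnSeries Γ F).coeff g = 0 := by
      intro i
      rw [← hahn_norm_le_iff]
      simpa using hcoef i
    let r : F[X] := ∑ i ∈ Finset.range (p.natDegree + 1),
      C ((p.coeff i : HahnSeries Γ F).coeff 0) * X ^ i
    have hr : r.coeff p.natDegree = 1 := by
      simp [r, coeff_C_mul, coeff_X_pow, hp.coeff_natDegree]
    have hrdeg : r.degree ≠ 0 := by
      intro h
      have := coeff_eq_zero_of_natDegree_lt (p := r) (n := p.natDegree)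
        (by rw [natDegree_eq_of_degree_eq_some h]; exact hdeg)
      rw [hr] at this
      exact one_ne_zero this
    obtain ⟨a, ha⟩ := IsAlgClosed.exists_root r hrdeg
    refine ⟨⟨HahnSeries.C a, hmono _ _⟩, ?_, ?_⟩
    · change ‖HahnSeries.single (0 : Γ) a‖ ≤ 1
      have : ‖HahnSeries.single (0 : Γ) a‖ ≤ Real.exp (-toReal (0 : Γ)) :=
        hahn_norm_le_iff.mpr fun g hg => HahnSeries.coeff_single_of_ne hg.ne
      simpa using this
    · have hev : ((p.eval ⟨HahnSeries.C a, hmono 0 a⟩ : S) : HahnSeries Γ F) =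
          (p.map S.subtype).eval (HahnSeries.C a) := by
        rw [eval_map]
        exact (hom_eval₂ p (RingHom.id S) S.subtype _)
      change ‖((p.eval ⟨HahnSeries.C a, hmono 0 a⟩ : S) : HahnSeries Γ F)‖ < 1
      have : ‖(p.map S.subtype).eval (HahnSeries.C a)‖ < Real.exp (-toReal (0 : Γ)) := by
        rw [hahn_norm_lt_iff]
        intro g hg
        rw [hahn_coeff_eval_C, natDegree_map]
        rcases hg.lt_or_eq with hg | rfl
        · refine Finset.sum_eq_zero fun i _ => ?_
          rw [coeff_map]
          simp [hcoef' i g hg]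
        · rw [IsRoot.def] at ha
          simp only [r, eval_finsetSum, eval_mul, eval_C, eval_pow, eval_X] at ha
          simpa [coeff_map] using ha
      rw [hev]
      simpa using this

noncomputable instance : RealEmbedding ℚ where
  toReal := (Rat.castHom ℝ).toAddMonoidHom
  strictMono := Rat.cast_strictMono

noncomputable instance (Δ : Submodule ℚ ℝ) : RealEmbedding Δ where
  toReal := Δ.subtype.toAddMonoidHom
  strictMono := fun _ _ h => h

instance hahnSeries_rat_isAlgClosed [IsAlgClosed F] [CharZero F] :
    IsAlgClosed (HahnSeries ℚ F) := by
  have := hahn_isAlgClosed_subfield (Γ := ℚ) (F := F)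
    (fun γ n hn => ⟨γ / n, by simp; field_simp⟩) ⊤ isClosed_univ
    (fun _ _ => trivial)
  exact IsAlgClosed.of_ringEquiv _ _ Subfield.topEquiv

end NormedHahn

section Approximation

variable {Γ F : Type*} [AddCommGroup Γ] [LinearOrder Γ] [IsOrderedAddMonoid Γ] [Field F]

variable (Γ F) in
/-- The inclusion of the group algebra in the field of Hahn series. -/
noncomputable def toHahn : AddMonoidAlgebra F Γ →ₐ[F] HahnSeries Γ F :=
  AddMonoidAlgebra.lift F _ Γ
    { toFun := fun γ => HahnSeries.single γ.toAdd 1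
      map_one' := rfl
      map_mul' := fun a b => by simp [HahnSeries.single_mul_single] }

@[simp] lemma toHahn_single (γ : Γ) (a : F) :
    toHahn Γ F (AddMonoidAlgebra.single γ a) = HahnSeries.single γ a := by
  simp [toHahn, AddMonoidAlgebra.lift_single, ← HahnSeries.C_mul_eq_smul,
    HahnSeries.C_apply, HahnSeries.single_mul_single]

lemma coeff_toHahn (x : AddMonoidAlgebra F Γ) (g : Γ) :
    (toHahn Γ F x).coeff g = x.coeff g := by
  induction x using AddMonoidAlgebra.induction_on with
  | of m =>
    rw [show (AddMonoidAlgebra.of F Γ) (Multiplicative.ofAdd m) = AddMonoidAlgebra.single m 1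
      from rfl, toHahn_single, HahnSeries.coeff_single]
    simp [Finsupp.single_apply, eq_comm]
  | add x y hx hy => simp [hx, hy]
  | smul r x hx => simp [hx]

lemma toHahn_injective : Function.Injective (toHahn Γ F) := by
  intro x y h
  apply AddMonoidAlgebra.coeff_injective
  ext g
  rw [← coeff_toHahn, h, coeff_toHahn]

variable [RealEmbedding Γ]
open RealEmbedding

lemma inv_mem_of_isClosed_of_single_mem [Nontrivial Γ] (S : Subring (HahnSeries Γ F))
    (hS : IsClosed (S : Set (HahnSeries Γ F)))
    (hmono : ∀ (γ : Γ) (a : F), HahnSeries.single γ a ∈ S) (x : HahnSeries Γ F) (hx : x ∈ S) :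
    x⁻¹ ∈ S := by
  by_cases hx0 : x = 0
  · simp [hx0]
  have hc : x.coeff x.order ≠ 0 := HahnSeries.coeff_order_eq_zero.not.mpr hx0
  set m : HahnSeries Γ F := HahnSeries.single (-x.order) (x.coeff x.order)⁻¹ with hm
  have hm0 : m ≠ 0 := HahnSeries.single_ne_zero (inv_ne_zero hc)
  set y := 1 - m * x with hy
  have hyS : y ∈ S := S.sub_mem S.one_mem (S.mul_mem (hmono _ _) hx)
  have hy1 : ‖y‖ < 1 := by
    have : ‖y‖ < Real.exp (-toReal (0 : Γ)) := by
      rw [hahn_norm_lt_iff]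
      intro g hg
      rw [hy, hm, HahnSeries.coeff_sub, HahnSeries.coeff_single_mul]
      rcases hg.lt_or_eq with hg | rfl
      · rw [HahnSeries.coeff_eq_zero_of_lt_order (x := x) (i := g - -x.order),
          HahnSeries.coeff_one, if_neg hg.ne, mul_zero, sub_zero]
        rwa [sub_neg_eq_add, add_lt_iff_neg_right]
      · simp [inv_mul_cancel₀ hc]
    simpa using this
  have hinv : x⁻¹ = (1 - y)⁻¹ * m := by
    rw [hy, sub_sub_cancel, mul_inv]
    field_simp
  rw [hinv]
  refine S.mul_mem ?_ (hmono _ _)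
  exact hS.mem_of_tendsto (hasSum_geometric_of_norm_lt_one hy1)
    (Filter.Eventually.of_forall fun s => S.sum_mem fun n _ => S.pow_mem hyS n)

lemma continuous_coeff_prod_X_sub_C {R : Type*} [CommRing R] [TopologicalSpace R]
    [IsTopologicalRing R] {ι : Type*} (s : Finset ι) (k : ℕ) :
    Continuous fun r : ι → R => (∏ i ∈ s, (X - C (r i))).coeff k := by
  classical
  induction s using Finset.induction_on generalizing k with
  | empty => simpa using continuous_const
  | insert a s ha ih =>
    simp only [Finset.prod_insert ha, coeff_mul]
    refine continuous_finsetSum _ fun j _ => Continuous.mul ?_ (ih _)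
    simp only [coeff_sub, coeff_C]
    split_ifs
    · exact continuous_const.sub (continuous_apply a)
    · exact continuous_const

lemma exists_eq_map_univ_val {α : Type*} (m : Multiset α) {n : ℕ} (h : m.card = n) :
    ∃ r : Fin n → α, m = Finset.univ.val.map r := by
  have key : ∀ l : List α, ∀ n, l.length = n →
      ∃ r : Fin n → α, (l : Multiset α) = Finset.univ.val.map r := by
    rintro l n rfl
    exact ⟨l.get, by rw [Fin.univ_val_map, List.ofFn_get]⟩
  obtain ⟨r, hr⟩ := key m.toList n (m.length_toList.trans h)
  exact ⟨r, m.coe_toList ▸ hr⟩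

/-- Every monic polynomial over the group algebra of a divisible subgroup of the reals, over an
algebraically closed field of characteristic zero, is a product of linear factors up to an
arbitrarily small error. -/
theorem exists_prod_X_sub_C_approx [Nontrivial Γ] [IsAlgClosed F] [CharZero F]
    (hΓ : ∀ γ : Γ, ∀ n : ℕ, n ≠ 0 → ∃ γ', n • γ' = γ) (p : (AddMonoidAlgebra F Γ)[X])
    (hp : p.Monic) (M : ℝ) : ∃ b : Fin p.natDegree → AddMonoidAlgebra F Γ,
      ∀ k, ∀ g : Γ, toReal g < M → ((p - ∏ i, (X - C (b i))).coeff k).coeff g = 0 := by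
  let R : Subring (HahnSeries Γ F) := (toHahn Γ F).toRingHom.range.topologicalClosure
  have hR : IsClosed (R : Set (HahnSeries Γ F)) := Subring.isClosed_topologicalClosure _
  have hmem : ∀ x, toHahn Γ F x ∈ R := fun x =>
    Subring.le_topologicalClosure _ ⟨x, rfl⟩
  have hmono : ∀ (γ : Γ) (a : F), HahnSeries.single γ a ∈ R := fun γ a => by
    rw [← toHahn_single]; exact hmem _
  let S : Subfield (HahnSeries Γ F) :=
    { R with inv_mem' := inv_mem_of_isClosed_of_single_mem R hR hmono }
  have : IsAlgClosed S := hahn_isAlgClosed_subfield hΓ S hR hmono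
  let φ : AddMonoidAlgebra F Γ →+* S := (toHahn Γ F).toRingHom.codRestrict S hmem
  have hsplit := IsAlgClosed.splits (p.map φ)
  have hcard : (p.map φ).roots.card = p.natDegree := by
    rw [← hsplit.natDegree_eq_card_roots, hp.natDegree_map]
  obtain ⟨r, hr⟩ := exists_eq_map_univ_val (p.map φ).roots hcard
  have hprod : p.map (toHahn Γ F).toRingHom = ∏ i, (X - C (r i : HahnSeries Γ F)) := by
    have h1 := hsplit.eq_prod_roots_of_monic (hp.map φ)
    rw [hr, Multiset.map_map] at h1
    have h2 : p.map φ = ∏ i, (X - C (r i)) := h1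
    have h3 := congrArg (Polynomial.map S.subtype) h2
    rw [Polynomial.map_map, Polynomial.map_prod] at h3
    simpa using! h3
  obtain ⟨γ, hγ⟩ := exists_toReal_gt (Γ := Γ) M
  let U : Set (Fin p.natDegree → HahnSeries Γ F) :=
    ⋂ k ∈ Finset.range (p.natDegree + 1), {r' | ‖(∏ i, (X - C (r i : HahnSeries Γ F))).coeff k -
      (∏ i, (X - C (r' i))).coeff k‖ < Real.exp (-toReal γ)}
  have hU : IsOpen U := by
    refine isOpen_biInter_finset fun k _ => isOpen_lt ?_ continuous_const
    exact (continuous_const.sub (continuous_coeff_prod_X_sub_C _ k)).norm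
  have hrU : (fun i => (r i : HahnSeries Γ F)) ∈ U := by
    simp [U, Real.exp_pos]
  have hrcl : (fun i => (r i : HahnSeries Γ F)) ∈
      closure (Set.univ.pi fun _ : Fin p.natDegree => Set.range (toHahn Γ F)) := by
    rw [closure_pi_set]
    intro i _
    exact (r i).2
  obtain ⟨b', hbU, hb'⟩ := mem_closure_iff.mp hrcl U hU hrU
  choose b hb using fun i => hb' i trivial
  refine ⟨b, fun k g hg => ?_⟩
  have hmap : (∏ i, (X - C (b i))).map (toHahn Γ F).toRingHom = ∏ i, (X - C (b' i)) := by
    rw [Polynomial.map_prod]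
    refine Finset.prod_congr rfl fun i _ => ?_
    simp [← hb]
  by_cases hk : k < p.natDegree + 1
  · have h1 := Set.mem_iInter₂.mp hbU k (Finset.mem_range.mpr hk)
    rw [Set.mem_ofPred_eq, ← hprod, ← hmap, ← coeff_sub, ← Polynomial.map_sub, coeff_map,
      hahn_norm_lt_iff] at h1
    have h2 := h1 g (strictMono.le_iff_le.mp (hg.trans hγ).le)
    rwa [AlgHom.toRingHom_eq_coe, RingHom.coe_coe, coeff_toHahn] at h2
  · rw [coeff_sub, coeff_eq_zero_of_natDegree_lt (by omega), coeff_eq_zero_of_natDegree_lt]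
    · simp
    · rw [natDegree_prod_of_monic _ _ fun i _ => monic_X_sub_C _]
      simp; omega

end Approximation

section IntegralCoefficients

/-- A valuation subring containing a field contains everything algebraic over that field. -/
lemma ValuationSubring.mem_of_isAlgebraic {E L : Type*} [Field E] [Field L] [Algebra E L]
    (O : ValuationSubring L) (hO : ∀ x : E, algebraMap E L x ∈ O) {y : L}
    (hy : IsAlgebraic E y) : y ∈ O := by
  obtain ⟨p, hp, hpy⟩ := hy.isIntegral
  have hinteg : IsIntegral O y := by
    refine ⟨p.map ((algebraMap E L).codRestrict O.toSubring hO), hp.map _, ?_⟩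
    rw [eval₂_map]
    exact hpy
  obtain ⟨z, rfl⟩ := IsIntegrallyClosed.isIntegral_iff.mp hinteg
  exact z.2

lemma ValuationSubring.mem_of_monic {L : Type*} [Field L] (O : ValuationSubring L) {p : L[X]}
    (hp : p.Monic) (hO : ∀ i, p.coeff i ∈ O) {y : L} (hy : p.eval y = 0) : y ∈ O := by
  have hl : p ∈ lifts O.subtype := by
    rw [lifts_iff_coeff_lifts]
    intro i
    exact ⟨⟨_, hO i⟩, rfl⟩
  obtain ⟨q, hq, -, hqm⟩ := lifts_and_natDegree_eq_and_monic hl hp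
  have hinteg : IsIntegral O y := ⟨q, hqm, by
    rw [eval₂_eq_eval_map]
    exact hq ▸ hy⟩
  obtain ⟨z, rfl⟩ := IsIntegrallyClosed.isIntegral_iff.mp hinteg
  exact z.2

/-- An element of a group algebra which is integral over the group algebra of a subring has
integral coefficients. -/
theorem isIntegral_coeff_of_isIntegralElem {F A : Type*} [Field F] [AddCommGroup A] [LinearOrder A]
    [IsOrderedAddMonoid A] (R : Subring F) (g : AddMonoidAlgebra F A)
    (hg : (AddMonoidAlgebra.mapRingHom A R.subtype).IsIntegralElem g) (δ : A) :
    IsIntegral R (g.coeff δ) := by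
  classical
  by_contra hδ
  have hmem : g.coeff δ ∉ (integralClosure R F).toSubring := hδ
  have : IsIntegrallyClosedIn (integralClosure R F).toSubring F :=
    inferInstanceAs (IsIntegrallyClosedIn (integralClosure R F) F)
  obtain ⟨V, hRV, hV⟩ := Subring.exists_le_valuationSubring_of_isIntegrallyClosedIn hmem
  have hRV' : R ≤ V.toSubring := fun x hx => hRV (algebraMap_mem (integralClosure R F) ⟨x, hx⟩)
  have hne : g.coeff.support.Nonempty :=
    ⟨δ, Finsupp.mem_support_iff.mpr fun h => hV (h ▸ V.zero_mem)⟩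
  obtain ⟨δ₁, hδ₁, hmax⟩ := g.coeff.support.exists_max_image (fun a => V.valuation (g.coeff a)) hne
  set c := g.coeff δ₁ with hc
  have hc0 : c ≠ 0 := Finsupp.mem_support_iff.mp hδ₁
  have hmax' : ∀ a, V.valuation (g.coeff a) ≤ V.valuation c := by
    intro a
    by_cases ha : g.coeff a = 0
    · simp [ha]
    · exact hmax a (Finsupp.mem_support_iff.mpr ha)
  have hc1 : 1 < V.valuation c := by
    refine lt_of_lt_of_le ?_ (hmax' δ)
    exact not_le.mp fun h => hV ((V.valuation_le_one_iff _).mp h)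
  have hcinv : V.valuation c⁻¹ < 1 := by
    rw [map_inv₀]; exact inv_lt_one_of_one_lt₀ hc1
  let c' : V := ⟨c⁻¹, (V.valuation_le_one_iff _).mp hcinv.le⟩
  have hc'res : IsLocalRing.residue V c' = 0 := by
    rw [IsLocalRing.residue_eq_zero_iff]
    exact (V.valuation_lt_one_iff c').mpr hcinv
  have hdiv : ∀ a, c⁻¹ * g.coeff a ∈ V := fun a => by
    rw [← V.valuation_le_one_iff, map_mul, map_inv₀]
    exact (inv_mul_le_one₀ (zero_lt_one.trans hc1)).mpr (hmax' a)
  let j := AddMonoidAlgebra.mapRingHom A V.subtype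
  have hj : Function.Injective j := by
    intro x y hxy
    apply AddMonoidAlgebra.coeff_injective
    ext a
    have := congrArg (fun z => z.coeff a) hxy
    simpa [j] using this
  let h : AddMonoidAlgebra V A := .ofCoeff
    (Finsupp.onFinset g.coeff.support (fun a => ⟨c⁻¹ * g.coeff a, hdiv a⟩) fun a ha => by
      rw [Finsupp.mem_support_iff]
      rintro h0
      exact ha (Subtype.ext (by simp [h0])))
  have hh : j h = AddMonoidAlgebra.single 0 c⁻¹ * g := by
    apply AddMonoidAlgebra.coeff_injective
    ext a
    rw [AddMonoidAlgebra.coeff_mapRingHom]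
    rw [AddMonoidAlgebra.coeff_single_zero_mul]
    rfl
  obtain ⟨p, hp, hpg⟩ := hg
  let i := AddMonoidAlgebra.mapRingHom A (Subring.inclusion hRV')
  let q := (p.map i).scaleRoots (AddMonoidAlgebra.single 0 c')
  have hji : j.comp i = AddMonoidAlgebra.mapRingHom A R.subtype := by
    ext x
    · simp [j, i, Subring.inclusion]
    · simp [j, i]
  have hqh : q.eval h = 0 := by
    apply hj
    rw [map_zero, ← eval₂_id, hom_eval₂, RingHom.comp_id, hh]
    have := scaleRoots_eval₂_eq_zero (p := p.map i) j (r := g) (s := AddMonoidAlgebra.single 0 c')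
      (by rw [eval₂_map, hji]; exact hpg)
    have hs : j (AddMonoidAlgebra.single 0 c') = AddMonoidAlgebra.single 0 c⁻¹ := by
      simp [j, c']
    rwa [hs] at this
  let ρ := AddMonoidAlgebra.mapRingHom A (IsLocalRing.residue V)
  have hρ : ρ (AddMonoidAlgebra.single 0 c') = 0 := by
    simp [ρ, hc'res]
  have hqρ : q.map ρ = X ^ (p.map i).natDegree := by
    rw [map_scaleRoots _ _ _ (by rw [(hp.map i).leadingCoeff, map_one]; exact one_ne_zero), hρ,
      scaleRoots_zero, ((hp.map i).map ρ).leadingCoeff, one_smul, (hp.map i).natDegree_map]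
  have hzero : (ρ h) ^ (p.map i).natDegree = 0 := by
    have := congrArg (eval (ρ h)) hqρ
    rw [eval_pow, eval_X, eval_map, eval₂_hom, hqh, map_zero] at this
    exact this.symm
  have hone : (ρ h).coeff δ₁ = 1 := by
    rw [AddMonoidAlgebra.coeff_mapRingHom]
    have : h.coeff δ₁ = 1 := Subtype.ext (inv_mul_cancel₀ hc0)
    rw [this, map_one]
  rw [eq_zero_of_pow_eq_zero hzero] at hone
  simp at hone

end IntegralCoefficients

section DFinite

variable {K L : Type*} [Field K] [Field L] [Algebra K L]

/-- An element lying in a finite-dimensional `F`-subspace stable under the derivation `θ`. -/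
def IsDFinite (θ : Derivation K L L) (F : IntermediateField K L) (x : L) : Prop :=
  ∃ V : Submodule F L, FiniteDimensional F V ∧ x ∈ V ∧ ∀ v ∈ V, θ v ∈ V

variable {θ : Derivation K L L} {F : IntermediateField K L}

lemma IsDFinite.zero : IsDFinite θ F 0 :=
  ⟨⊥, inferInstance, zero_mem _, fun v hv => by
    rw [Submodule.mem_bot] at hv ⊢; rw [hv, map_zero]⟩

lemma IsDFinite.add {x y : L} (hx : IsDFinite θ F x) (hy : IsDFinite θ F y) :
    IsDFinite θ F (x + y) := by
  obtain ⟨V, hV, hxV, hVθ⟩ := hx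
  obtain ⟨W, hW, hyW, hWθ⟩ := hy
  refine ⟨V ⊔ W, inferInstance, Submodule.add_mem_sup hxV hyW, fun v hv => ?_⟩
  obtain ⟨a, ha, b, hb, rfl⟩ := Submodule.mem_sup.mp hv
  rw [map_add]
  exact Submodule.add_mem_sup (hVθ a ha) (hWθ b hb)

lemma IsDFinite.sum {α : Type*} (s : Finset α) {x : α → L} (hx : ∀ i ∈ s, IsDFinite θ F (x i)) :
    IsDFinite θ F (∑ i ∈ s, x i) :=
  Finset.sum_induction _ _ (fun _ _ => IsDFinite.add) .zero hx

lemma IsDFinite.mul_right {x z : L} {a : F} (hx : IsDFinite θ F x) (hz : θ z = a * z) :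
    IsDFinite θ F (x * z) := by
  obtain ⟨V, hV, hxV, hVθ⟩ := hx
  refine ⟨V.map (LinearMap.mulRight F z), inferInstance, ⟨x, hxV, rfl⟩, ?_⟩
  rintro _ ⟨v, hv, rfl⟩
  refine ⟨θ v + a • v, V.add_mem (hVθ v hv) (V.smul_mem a hv), ?_⟩
  simp only [LinearMap.mulRight_apply, Derivation.leibniz, hz, smul_eq_mul, Algebra.smul_def,
    IntermediateField.algebraMap_apply]
  ring

lemma derivation_mem_adjoin {S : Set L} {E : IntermediateField K L} (hSE : S ⊆ E)
    (hS : ∀ s ∈ S, θ s ∈ E) {x : L} (hx : x ∈ IntermediateField.adjoin K S) : θ x ∈ E := by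
  have hle : IntermediateField.adjoin K S ≤ E := IntermediateField.adjoin_le_iff.mpr hSE
  induction hx using IntermediateField.adjoin_induction with
  | mem x hx => exact hS x hx
  | algebraMap x => simp
  | add x y hx hy h₁ h₂ => rw [map_add]; exact add_mem h₁ h₂
  | inv x hx h =>
    rw [Derivation.leibniz_inv, smul_eq_mul, neg_mul]
    exact neg_mem (mul_mem (pow_mem (inv_mem (hle hx)) 2) h)
  | mul x y hx hy h₁ h₂ =>
    rw [Derivation.leibniz, smul_eq_mul, smul_eq_mul]
    exact add_mem (mul_mem (hle hx) h₂) (mul_mem (hle hy) h₁)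

lemma derivation_aeval_mem (hF : ∀ x ∈ F, θ x ∈ F) (φ : L) (p : F[X]) :
    θ (aeval φ p) - aeval φ (derivative p) * θ φ ∈ IntermediateField.adjoin F {φ} := by
  induction p using Polynomial.induction_on' with
  | add p q hp hq =>
    have := add_mem hp hq
    simp only [map_add] at this ⊢
    convert this using 1
    ring
  | monomial n a =>
    have : θ (aeval φ (monomial n a)) - aeval φ (derivative (monomial n a)) * θ φ =
        θ a * φ ^ n := by
      simp only [aeval_monomial, derivative_monomial, Derivation.leibniz, Derivation.leibniz_pow,
        smul_eq_mul, nsmul_eq_mul, map_mul, map_natCast, IntermediateField.algebraMap_apply]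
      ring
    rw [this]
    refine mul_mem ?_ (pow_mem (IntermediateField.mem_adjoin_simple_self F φ) n)
    exact (IntermediateField.adjoin F {φ}).algebraMap_mem ⟨θ a, hF a a.2⟩

lemma derivation_mem_adjoin_simple [CharZero K] (hF : ∀ x ∈ F, θ x ∈ F) {φ : L}
    (hφ : IsAlgebraic F φ) {x : L} (hx : x ∈ IntermediateField.adjoin F {φ}) :
    θ x ∈ IntermediateField.adjoin F {φ} := by
  have : CharZero F := charZero_of_injective_algebraMap (algebraMap K F).injective
  have hsep : aeval φ (derivative (minpoly F φ)) ≠ 0 :=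
    (minpoly.irreducible hφ.isIntegral).separable.aeval_derivative_ne_zero (minpoly.aeval F φ)
  have hθφ : θ φ ∈ IntermediateField.adjoin F {φ} := by
    have h := derivation_aeval_mem hF φ (minpoly F φ)
    rw [minpoly.aeval, map_zero, zero_sub, neg_mem_iff] at h
    have h' : aeval φ (derivative (minpoly F φ)) ∈ IntermediateField.adjoin F {φ} :=
      IntermediateField.algebra_adjoin_le_adjoin F {φ} (aeval_mem_adjoin_singleton F φ)
    simpa [hsep] using mul_mem (inv_mem h') h
  rw [← IntermediateField.mem_restrictScalars (K := K),
    IntermediateField.restrictScalars_adjoin] at hx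
  refine (IntermediateField.mem_restrictScalars (K := K)).mp (derivation_mem_adjoin
    (E := (IntermediateField.adjoin F {φ}).restrictScalars K) ?_ ?_ hx)
  · rintro y (hy | hy)
    · exact (IntermediateField.adjoin F {φ}).algebraMap_mem ⟨y, hy⟩
    · exact IntermediateField.subset_adjoin F {φ} hy
  · rintro y (hy | hy)
    · exact (IntermediateField.adjoin F {φ}).algebraMap_mem ⟨θ y, hF y hy⟩
    · rw [Set.mem_singleton_iff.mp hy]; exact hθφ

lemma IsDFinite.of_isAlgebraic [CharZero K] (hF : ∀ x ∈ F, θ x ∈ F) {φ : L}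
    (hφ : IsAlgebraic F φ) : IsDFinite θ F φ :=
  ⟨(IntermediateField.adjoin F {φ}).toSubalgebra.toSubmodule,
    IntermediateField.adjoin.finiteDimensional hφ.isIntegral,
    IntermediateField.mem_adjoin_simple_self F φ,
    fun _ hv => derivation_mem_adjoin_simple hF hφ hv⟩

lemma derivation_mem_algebraicClosure [CharZero K] (hF : ∀ x ∈ F, θ x ∈ F) {φ : L}
    (hφ : φ ∈ algebraicClosure F L) : θ φ ∈ algebraicClosure F L := by
  have hφ' : IsAlgebraic F φ := mem_algebraicClosure_iff.mp hφ
  exact IntermediateField.adjoin_le_iff.mpr (Set.singleton_subset_iff.mpr hφ)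
    (derivation_mem_adjoin_simple hF hφ' (IntermediateField.mem_adjoin_simple_self F φ))

/-- A `D`-finite element satisfies a linear differential equation. -/
lemma IsDFinite.exists_sum_eq_zero {x : L} (hx : IsDFinite θ F x) :
    ∃ (n : ℕ) (q : Fin n → F), q ≠ 0 ∧ ∑ i, (q i : L) * (θ^[i] x) = 0 := by
  obtain ⟨V, hV, hxV, hVθ⟩ := hx
  let v : Fin (Module.finrank F V + 1) → V := fun i =>
    ⟨θ^[i] x, Nat.recOn (i : ℕ) hxV fun n hn => by
      rw [Function.iterate_succ_apply']; exact hVθ _ hn⟩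
  have hv : ¬ LinearIndependent F v := fun h => by
    have := h.fintype_card_le_finrank
    simp at this
  rw [Fintype.not_linearIndependent_iff] at hv
  obtain ⟨q, hq, i, hi⟩ := hv
  refine ⟨_, q, fun h => hi (congrFun h i), ?_⟩
  have := congrArg Subtype.val hq
  simpa [v, Algebra.smul_def] using this

end DFinite

section CoarseExpansion

open RealEmbedding

variable {𝓡 𝕃 Δ F : Type*} [Field 𝓡] [LinearOrder 𝓡] [IsStrictOrderedRing 𝓡] [Field 𝕃]
  [AddCommGroup Δ] [LinearOrder Δ] [RealEmbedding Δ] [Field F] [Algebra F 𝕃]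

variable (F) in
/-- The valuation of `c * z δ` is about `toReal δ * N`, up to infinitesimal multiples of `N`, for
nonzero coefficients `c`. -/
structure IsCoarseScale (ord : AddValuation 𝕃 (WithTop 𝓡)) (z : Multiplicative Δ →* 𝕃)
    (N : 𝓡) : Prop where
  pos : 0 < N
  lt_ord : ∀ c : F, c ≠ 0 → ∀ (δ : Δ) (q : ℚ), (q : ℝ) < toReal δ →
    ((q * N : 𝓡) : WithTop 𝓡) < ord (c • z (.ofAdd δ))
  ord_lt : ∀ c : F, c ≠ 0 → ∀ (δ : Δ) (q : ℚ), toReal δ < (q : ℝ) →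
    ord (c • z (.ofAdd δ)) < ((q * N : 𝓡) : WithTop 𝓡)

lemma addValuation_prod_lt {α : Type*} (ord : AddValuation 𝕃 (WithTop 𝓡)) {s : Finset α}
    (hs : s.Nonempty) {x : α → 𝕃} {c : 𝓡} (hx : ∀ i ∈ s, ord (x i) < (c : WithTop 𝓡)) :
    ord (∏ i ∈ s, x i) < ((s.card * c : 𝓡) : WithTop 𝓡) := by
  induction hs using Finset.Nonempty.cons_induction with
  | singleton a => simpa using hx
  | cons a s ha hs ih =>
    have h₁ := hx a (Finset.mem_cons_self a s)
    have h₂ := ih fun i hi => hx i (Finset.mem_cons_of_mem hi)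
    rw [Finset.prod_cons, AddValuation.map_mul, Finset.card_cons]
    generalize ord (x a) = u at h₁ ⊢
    generalize ord (∏ i ∈ s, x i) = v at h₂ ⊢
    lift u to 𝓡 using ne_top_of_lt h₁
    lift v to 𝓡 using ne_top_of_lt h₂
    rw [← WithTop.coe_add]
    rw [WithTop.coe_lt_coe] at *
    push_cast
    linarith

namespace IsCoarseScale

variable {ord : AddValuation 𝕃 (WithTop 𝓡)} {z : Multiplicative Δ →* 𝕃} {N : 𝓡}

lemma ord_ne_top (h : IsCoarseScale F ord z N) {c : F} (hc : c ≠ 0) (δ : Δ) :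
    ord (c • z (.ofAdd δ)) ≠ ⊤ := by
  obtain ⟨q, hq⟩ := exists_rat_gt (toReal δ)
  exact ne_top_of_lt (h.ord_lt c hc δ q hq)

lemma exists_ord_lift (h : IsCoarseScale F ord z N) {b : AddMonoidAlgebra F Δ} (hb : b ≠ 0) :
    ∃ δ, b.coeff δ ≠ 0 ∧ (∀ δ', b.coeff δ' ≠ 0 → δ ≤ δ') ∧
      ord (AddMonoidAlgebra.lift F 𝕃 Δ z b) = ord (b.coeff δ • z (.ofAdd δ)) := by
  classical
  have hne : b.coeff.support.Nonempty := by
    rw [Finsupp.support_nonempty_iff]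
    exact fun h0 => hb (AddMonoidAlgebra.coeff_injective h0)
  set δ := b.coeff.support.min' hne with hδ
  have hδ' : δ ∈ b.coeff.support := Finset.min'_mem _ _
  have hδ0 := Finsupp.mem_support_iff.mp hδ'
  refine ⟨δ, hδ0, fun δ' h' => Finset.min'_le _ _ (Finsupp.mem_support_iff.mpr h'), ?_⟩
  rw [AddMonoidAlgebra.lift_apply, Finsupp.sum, ← Finset.add_sum_erase _ _ hδ']
  refine AddValuation.map_add_eq_of_lt_left _ (AddValuation.map_lt_sum _ (h.ord_ne_top hδ0 δ) ?_)
  intro ε hε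
  obtain ⟨hne', hε⟩ := Finset.mem_erase.mp hε
  have hlt : δ < ε := lt_of_le_of_ne (Finset.min'_le _ _ hε) (Ne.symm hne')
  obtain ⟨q, hq₁, hq₂⟩ := exists_rat_btwn (strictMono hlt)
  exact (h.ord_lt _ hδ0 _ _ hq₁).trans (h.lt_ord _ (Finsupp.mem_support_iff.mp hε) _ _ hq₂)

lemma lift_injective (h : IsCoarseScale F ord z N) :
    Function.Injective (AddMonoidAlgebra.lift F 𝕃 Δ z) := by
  rw [injective_iff_map_eq_zero]
  intro b hb
  by_contra hb0
  obtain ⟨δ, hδ, -, ho⟩ := h.exists_ord_lift hb0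
  rw [hb, AddValuation.map_zero] at ho
  exact h.ord_ne_top hδ δ ho.symm

lemma le_ord_lift (h : IsCoarseScale F ord z N) {b : AddMonoidAlgebra F Δ} {M : ℝ}
    (hb : ∀ δ, toReal δ < M → b.coeff δ = 0) {q : ℚ} (hq : (q : ℝ) < M) :
    ((q * N : 𝓡) : WithTop 𝓡) ≤ ord (AddMonoidAlgebra.lift F 𝕃 Δ z b) := by
  by_cases hb0 : b = 0
  · simp [hb0]
  obtain ⟨δ, hδ, -, ho⟩ := h.exists_ord_lift hb0
  rw [ho]
  exact (h.lt_ord _ hδ _ _ (hq.trans_le (not_lt.mp fun hlt => hδ (hb δ hlt)))).le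

lemma coeff_eq_zero (h : IsCoarseScale F ord z N) {b : AddMonoidAlgebra F Δ} {q : ℚ}
    (hb : ((q * N : 𝓡) : WithTop 𝓡) ≤ ord (AddMonoidAlgebra.lift F 𝕃 Δ z b)) {δ : Δ}
    (hδ : toReal δ < q) : b.coeff δ = 0 := by
  by_contra hne
  have hb0 : b ≠ 0 := by rintro rfl; exact hne rfl
  obtain ⟨δ', hδ', hmin, ho⟩ := h.exists_ord_lift hb0
  have := h.ord_lt _ hδ' _ _ ((strictMono.monotone (hmin δ hne)).trans_lt hδ)
  rw [← ho] at this
  exact absurd hb (not_le.mpr this)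

/-- A root of a monic polynomial over the group algebra is approximated by elements of the group
algebra. -/
lemma exists_approx [IsOrderedAddMonoid Δ] [Nontrivial Δ] [IsAlgClosed F] [CharZero F]
    (h : IsCoarseScale F ord z N)
    (hΔ : ∀ γ : Δ, ∀ n : ℕ, n ≠ 0 → ∃ γ', n • γ' = γ) {p : (AddMonoidAlgebra F Δ)[X]}
    (hp : p.Monic) {G : 𝕃} (hG : eval₂ (AddMonoidAlgebra.lift F 𝕃 Δ z).toRingHom G p = 0)
    {D : ℕ} (hD : ((-(D * N) : 𝓡) : WithTop 𝓡) ≤ ord G) (M : ℕ) :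
    ∃ b : AddMonoidAlgebra F Δ,
      ((M * N : 𝓡) : WithTop 𝓡) ≤ ord (G - AddMonoidAlgebra.lift F 𝕃 Δ z b) := by
  set ev := (AddMonoidAlgebra.lift F 𝕃 Δ z).toRingHom with hev
  set n := p.natDegree with hn
  obtain ⟨b, hb⟩ := exists_prod_X_sub_C_approx hΔ p hp (n * M + n * D + 1)
  by_contra! hlt
  have hn0 : 0 < n := by
    rcases Nat.eq_zero_or_pos n with h0 | h0
    · rw [hp.natDegree_eq_zero.mp h0] at hG
      simp at hG
    · exact h0
  have hdeg : (p - ∏ i, (X - C (b i))).natDegree ≤ n := by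
    refine (natDegree_sub_le _ _).trans (max_le le_rfl ?_)
    rw [natDegree_prod_of_monic _ _ fun i _ => monic_X_sub_C _]
    simp [hn]
  have key : ∏ i, (G - ev (b i)) = -eval₂ ev G (p - ∏ i, (X - C (b i))) := by
    rw [eval₂_sub, hG, zero_sub, neg_neg, eval₂_finsetProd]
    simp
  have hlow : ((n * (M * N) : 𝓡) : WithTop 𝓡) ≤ ord (∏ i, (G - ev (b i))) := by
    rw [key, AddValuation.map_neg, eval₂_eq_sum_range]
    refine AddValuation.map_le_sum _ fun k hk => ?_
    rw [AddValuation.map_mul, AddValuation.map_pow]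
    have hk' : k ≤ n := (Nat.lt_succ_iff.mp (Finset.mem_range.mp hk)).trans hdeg
    have h₁ := h.le_ord_lift (hb k) (q := n * M + n * D) (by push_cast; linarith)
    have h₂ := nsmul_le_nsmul_right hD k
    refine le_trans ?_ (add_le_add h₁ h₂)
    rw [← WithTop.coe_nsmul, ← WithTop.coe_add, WithTop.coe_le_coe]
    push_cast
    have h₃ : (k : 𝓡) * (D * N) ≤ n * (D * N) :=
      mul_le_mul_of_nonneg_right (by exact_mod_cast hk') (mul_nonneg (Nat.cast_nonneg _) h.pos.le)
    rw [nsmul_eq_mul]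
    linarith
  have hup := addValuation_prod_lt ord (s := Finset.univ) (c := M * N)
    (x := fun i => G - ev (b i)) ⟨⟨0, hn0⟩, Finset.mem_univ _⟩ fun i _ => hlt (b i)
  rw [Finset.card_univ, Fintype.card_fin] at hup
  exact absurd hlow (not_le.mpr hup)

end IsCoarseScale

end CoarseExpansion

section GeneralLemmas

lemma RingHom.isIntegralElem_of_coeff_mem {A L : Type*} [CommRing A] [CommRing L] [Nontrivial L]
    (f : A →+* L) {p : L[X]} (hp : p.Monic) (hf : ∀ i, p.coeff i ∈ f.range) {x : L}
    (hx : p.eval x = 0) : f.IsIntegralElem x := by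
  have hl : p ∈ lifts f := (lifts_iff_coeff_lifts p).mpr hf
  obtain ⟨q, hq, -, hqm⟩ := lifts_and_natDegree_eq_and_monic hl hp
  exact ⟨q, hqm, by rw [eval₂_eq_eval_map, hq, hx]⟩

/-- The elements whose valuation is bounded below by the opposite of an element of `H`. -/
def AddValuation.boundedSubring {𝓡 𝕃 : Type*} [Field 𝓡] [LinearOrder 𝓡] [IsStrictOrderedRing 𝓡]
    [Field 𝕃] (ord : AddValuation 𝕃 (WithTop 𝓡)) (H : AddSubmonoid 𝓡) : ValuationSubring 𝕃 where
  carrier := {h | ∃ a ∈ H, ((-a : 𝓡) : WithTop 𝓡) ≤ ord h}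
  mul_mem' := by
    rintro x y ⟨a, ha, hx⟩ ⟨b, hb, hy⟩
    refine ⟨a + b, H.add_mem ha hb, ?_⟩
    rw [AddValuation.map_mul, neg_add, WithTop.coe_add]
    exact add_le_add hx hy
  one_mem' := ⟨0, H.zero_mem, by simp⟩
  add_mem' := by
    rintro x y ⟨a, ha, hx⟩ ⟨b, hb, hy⟩
    rcases ord.map_add' x y with h | h
    · exact ⟨a, ha, hx.trans h⟩
    · exact ⟨b, hb, hy.trans h⟩
  zero_mem' := ⟨0, H.zero_mem, by simp⟩
  neg_mem' := by
    rintro x ⟨a, ha, hx⟩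
    exact ⟨a, ha, by rwa [AddValuation.map_neg]⟩
  mem_or_inv_mem' x := by
    rcases le_total 0 (ord x) with h | h
    · exact .inl ⟨0, H.zero_mem, by simpa using h⟩
    · refine .inr ⟨0, H.zero_mem, ?_⟩
      rw [AddValuation.map_inv, neg_zero, WithTop.coe_zero]
      generalize ord x = v at h ⊢
      cases v with
      | top => simp at h
      | coe a =>
        have : a ≤ 0 := by exact_mod_cast h
        rw [← WithTop.LinearOrderedAddCommGroup.coe_neg]
        exact_mod_cast neg_nonneg.mpr this

/-- A finite-dimensional space of elements of an ordered field has a largest archimedean scale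
`N`; the standard parts of the quotients by `N` form a linear functional. -/
lemma exists_scale {𝓡 : Type*} [Field 𝓡] [LinearOrder 𝓡] [IsStrictOrderedRing 𝓡]
    (Γ : Submodule ℚ 𝓡) [FiniteDimensional ℚ Γ] (hΓ : Γ ≠ ⊥) :
    ∃ N : 𝓡, 0 < N ∧ (∀ γ ∈ Γ, ∃ n : ℕ, |γ| ≤ n * N) ∧ ∃ s : Γ →ₗ[ℚ] ℝ, s ≠ 0 ∧
      (∀ (γ : Γ) (q : ℚ), (q : ℝ) < s γ → q * N < γ) ∧
      (∀ (γ : Γ) (q : ℚ), s γ < q → (γ : 𝓡) < q * N) := by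
  let b := Module.finBasis ℚ Γ
  have : Nontrivial Γ := Submodule.nontrivial_iff_ne_bot.mpr hΓ
  have : Nonempty (Fin (Module.finrank ℚ Γ)) := b.index_nonempty
  obtain ⟨i, -, hi⟩ := Finset.exists_max_image Finset.univ (fun j => |(b j : 𝓡)|)
    Finset.univ_nonempty
  set N : 𝓡 := |(b i : 𝓡)| with hNdef
  have hN : 0 < N := abs_pos.mpr fun h => b.ne_zero i (Subtype.ext h)
  have hNΓ : N ∈ Γ := by
    rcases abs_choice (b i : 𝓡) with h | h <;> rw [hNdef, h]
    · exact (b i).2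
    · exact Γ.neg_mem (b i).2
  have hbound : ∀ γ ∈ Γ, ∃ n : ℕ, |γ| ≤ n * N := by
    intro γ hγ
    obtain ⟨n, hn⟩ := exists_nat_ge (∑ j, |b.repr ⟨γ, hγ⟩ j|)
    refine ⟨n, ?_⟩
    have h₁ : γ = ∑ j, (b.repr ⟨γ, hγ⟩ j : 𝓡) * (b j : 𝓡) := by
      have := congrArg Subtype.val (b.sum_repr ⟨γ, hγ⟩)
      simp only [AddSubmonoidClass.coe_finsetSum, Submodule.coe_smul, Rat.smul_def] at this
      exact this.symm
    calc |γ| = |∑ j, (b.repr ⟨γ, hγ⟩ j : 𝓡) * (b j : 𝓡)| := by rw [← h₁]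
      _ ≤ ∑ j, |(b.repr ⟨γ, hγ⟩ j : 𝓡) * (b j : 𝓡)| := Finset.abs_sum_le_sum_abs _ _
      _ ≤ ∑ j, ((|b.repr ⟨γ, hγ⟩ j| : ℚ) : 𝓡) * N := Finset.sum_le_sum fun j _ => by
          rw [abs_mul, Rat.cast_abs]
          exact mul_le_mul_of_nonneg_left (hi j (Finset.mem_univ j)) (abs_nonneg _)
      _ = ((∑ j, |b.repr ⟨γ, hγ⟩ j| : ℚ) : 𝓡) * N := by rw [Rat.cast_sum, Finset.sum_mul]
      _ ≤ n * N := mul_le_mul_of_nonneg_right (by exact_mod_cast hn) hN.le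
  have hfin : ∀ γ : Γ, 0 ≤ ArchimedeanClass.mk ((γ : 𝓡) / N) := by
    intro γ
    obtain ⟨n, hn⟩ := hbound γ γ.2
    rw [← ArchimedeanClass.mk_one, ArchimedeanClass.mk_le_mk]
    refine ⟨n, ?_⟩
    rw [abs_div, abs_of_pos hN, abs_one, nsmul_eq_mul, mul_one]
    exact (div_le_iff₀ hN).mpr hn
  have hq : ∀ q : ℚ, 0 ≤ ArchimedeanClass.mk (q : 𝓡) := ArchimedeanClass.mk_ratCast_nonneg
  refine ⟨N, hN, hbound, ⟨⟨fun γ => ArchimedeanClass.stdPart ((γ : 𝓡) / N), ?_⟩, ?_⟩, ?_, ?_, ?_⟩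
  · intro x y
    rw [Submodule.coe_add, add_div, ArchimedeanClass.stdPart_add (hfin x) (hfin y)]
  · intro q x
    simp only [Submodule.coe_smul, Rat.smul_def, RingHom.id_apply]
    rw [mul_div_assoc, ArchimedeanClass.stdPart_mul (hq q) (hfin x),
      ArchimedeanClass.stdPart_ratCast]
  · intro h
    have := LinearMap.congr_fun h ⟨N, hNΓ⟩
    simp [div_self hN.ne'] at this
  · intro γ q h
    rw [← lt_div_iff₀ hN]
    by_contra! hle
    have := ArchimedeanClass.stdPart_monotoneOn (hfin γ) (hq q) hle
    rw [ArchimedeanClass.stdPart_ratCast] at this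
    exact absurd h (not_lt.mpr this)
  · intro γ q h
    rw [← div_lt_iff₀ hN]
    by_contra! hle
    have := ArchimedeanClass.stdPart_monotoneOn (hq q) (hfin γ) hle
    rw [ArchimedeanClass.stdPart_ratCast] at this
    exact absurd h (not_lt.mpr this)

/-- Averaging over conjugates makes integral coefficients rational over the base field. -/
lemma exists_isIntegral_sum_eq {R M L α : Type*} [CommRing R] [Field M] [CharZero M] [Field L]
    [Algebra R M] [Algebra M L] [Algebra R L] [IsScalarTower R M L] (s : Finset α) (φ : α → L)
    (hφ : ∀ i ∈ s, IsIntegral R (φ i)) (z : α → M) (G : M)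
    (hG : algebraMap M L G = ∑ i ∈ s, algebraMap M L (z i) * φ i) :
    ∃ ψ : α → M, (∀ i ∈ s, ∃ n : ℕ, n ≠ 0 ∧ IsIntegral R (n * ψ i)) ∧ G = ∑ i ∈ s, z i * ψ i := by
  classical
  let E := IntermediateField.adjoin M (φ '' s)
  have hE : FiniteDimensional M E := by
    have : Finite (φ '' (s : Set α)) := (s.finite_toSet.image φ).to_subtype
    refine IntermediateField.finiteDimensional_adjoin ?_
    rintro _ ⟨i, hi, rfl⟩
    exact (hφ i hi).tower_top
  have : IsScalarTower R E L := .of_algebraMap_eq fun _ => rfl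
  have hmem : ∀ i ∈ s, φ i ∈ E := fun i hi => IntermediateField.subset_adjoin M _ ⟨i, hi, rfl⟩
  let φ' : α → E := fun i => if h : i ∈ s then ⟨φ i, hmem i h⟩ else 0
  have hφ' : ∀ i ∈ s, (φ' i : L) = φ i := fun i hi => by simp [φ', hi]
  set n := Module.finrank M E with hn
  have hn0 : (n : M) ≠ 0 := Nat.cast_ne_zero.mpr Module.finrank_pos.ne'
  have hG' : algebraMap M E G = ∑ i ∈ s, z i • φ' i := by
    apply Subtype.val_injective
    have : ((algebraMap M E G : E) : L) = algebraMap M L G := rfl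
    rw [this, hG, AddSubmonoidClass.coe_finsetSum]
    refine Finset.sum_congr rfl fun i hi => ?_
    rw [IntermediateField.coe_smul, Algebra.smul_def, hφ' i hi]
  refine ⟨fun i => (n : M)⁻¹ * Algebra.trace M E (φ' i), fun i hi => ⟨n, ?_, ?_⟩, ?_⟩
  · exact Module.finrank_pos.ne'
  · rw [mul_inv_cancel_left₀ hn0]
    refine Algebra.isIntegral_trace ?_
    have h := hφ i hi
    rw [← hφ' i hi] at h
    exact (isIntegral_algebraMap_iff (algebraMap E L).injective).mp h
  · have := congrArg (Algebra.trace M E) hG'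
    rw [Algebra.trace_algebraMap, map_sum, ← hn, nsmul_eq_mul] at this
    rw [← inv_mul_cancel_left₀ hn0 G, this, Finset.mul_sum]
    refine Finset.sum_congr rfl fun i _ => ?_
    rw [map_smul, smul_eq_mul]
    ring

end GeneralLemmas

section SparseModel

/-- A field `𝕃` of series in `t` with exponents in `𝓡`, together with a ring `P` of sparse Laurent
polynomials in `t`. The involution `flip` of `P` replaces `t` by its inverse. -/
structure SparseModel (𝓡 K P 𝕃 : Type*) [Field 𝓡] [LinearOrder 𝓡] [IsStrictOrderedRing 𝓡]
    [Field K] [CommRing P] [Field 𝕃] [Algebra K P] [Algebra K 𝕃] [Algebra P 𝕃]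
    [IsScalarTower K P 𝕃] where
  ord : AddValuation 𝕃 (WithTop 𝓡)
  mono : Multiplicative 𝓡 →* P
  flip : P →ₐ[K] P
  θ : Derivation K 𝕃 𝕃
  κ : 𝓡 →+ K
  κ_injective : Function.Injective κ
  algebraMap_injective : Function.Injective (algebraMap P 𝕃)
  ord_mono : ∀ γ : 𝓡, ord (algebraMap P 𝕃 (mono (.ofAdd γ))) = γ
  ord_algebraMap : ∀ c : K, c ≠ 0 → ord (algebraMap K 𝕃 c) = 0
  flip_mono : ∀ γ : 𝓡, flip (mono (.ofAdd γ)) = mono (.ofAdd (-γ))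
  θ_mono : ∀ γ : 𝓡, θ (algebraMap P 𝕃 (mono (.ofAdd γ))) =
    κ γ • algebraMap P 𝕃 (mono (.ofAdd γ))
  ord_le_ord_θ : ∀ h, ord h ≤ ord (θ h)
  exists_leading : ∀ h, h ≠ 0 → ∃ (c : K) (γ : 𝓡), c ≠ 0 ∧ ord h = γ ∧
    (γ : WithTop 𝓡) < ord (h - c • algebraMap P 𝕃 (mono (.ofAdd γ)))
  exists_θ : ∀ p : P, ∃ p', algebraMap P 𝕃 p' = θ (algebraMap P 𝕃 p) ∧
    ord (algebraMap P 𝕃 (flip p)) ≤ ord (algebraMap P 𝕃 (flip p'))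
  ord_add_ord_flip_nonpos : ∀ p : P, p ≠ 0 →
    ord (algebraMap P 𝕃 p) + ord (algebraMap P 𝕃 (flip p)) ≤ 0

namespace SparseModel

variable {𝓡 K P 𝕃 : Type*} [Field 𝓡] [LinearOrder 𝓡] [IsStrictOrderedRing 𝓡]
    [Field K] [CommRing P] [Field 𝕃] [Algebra K P] [Algebra K 𝕃] [Algebra P 𝕃]
    [IsScalarTower K P 𝕃] (S : SparseModel 𝓡 K P 𝕃)

/-- The monomials with exponents in `Γ`. -/
def monomials (Γ : Submodule ℚ 𝓡) : Set P := {x | ∃ γ ∈ Γ, S.mono (.ofAdd γ) = x}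

/-- The algebra of Laurent polynomials with exponents in `Γ`. -/
def laurent (Γ : Submodule ℚ 𝓡) : Subalgebra K P := Algebra.adjoin K (S.monomials Γ)

lemma mono_mem_laurent {Γ : Submodule ℚ 𝓡} {γ : 𝓡} (hγ : γ ∈ Γ) :
    S.mono (.ofAdd γ) ∈ S.laurent Γ := Algebra.subset_adjoin ⟨γ, hγ, rfl⟩

lemma flip_mem_laurent {Γ : Submodule ℚ 𝓡} {p : P} (hp : p ∈ S.laurent Γ) :
    S.flip p ∈ S.laurent Γ := by
  have : S.laurent Γ ≤ (S.laurent Γ).comap S.flip := by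
    refine Algebra.adjoin_le ?_
    rintro _ ⟨γ, hγ, rfl⟩
    show S.flip _ ∈ S.laurent Γ
    rw [S.flip_mono]
    exact S.mono_mem_laurent (Γ.neg_mem hγ)
  exact this hp

lemma isIntegral_flip {Γ : Submodule ℚ 𝓡} {p : P} (hp : IsIntegral (S.laurent Γ) p) :
    IsIntegral (S.laurent Γ) (S.flip p) := by
  obtain ⟨f, hf, hfp⟩ := hp
  let σ : S.laurent Γ →+* S.laurent Γ :=
    (S.flip.toRingHom.comp (S.laurent Γ).val.toRingHom).codRestrict (S.laurent Γ)
      fun x => S.flip_mem_laurent x.2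
  refine ⟨f.map σ, hf.map σ, ?_⟩
  rw [eval₂_map]
  have := congrArg S.flip.toRingHom hfp
  rw [hom_eval₂, map_zero] at this
  exact this

lemma algebraMap_mem_boundedSubring (H : AddSubmonoid 𝓡) {Γ : Submodule ℚ 𝓡}
    (hH : ∀ γ ∈ Γ, γ ∈ H) {p : P} (hp : p ∈ S.laurent Γ) :
    algebraMap P 𝕃 p ∈ S.ord.boundedSubring H := by
  induction hp using Algebra.adjoin_induction with
  | mem x hx =>
    obtain ⟨γ, hγ, rfl⟩ := hx
    exact ⟨-γ, hH _ (Γ.neg_mem hγ), by rw [S.ord_mono, neg_neg]⟩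
  | algebraMap c =>
    rw [← IsScalarTower.algebraMap_apply]
    by_cases hc : c = 0
    · rw [hc, map_zero]; exact zero_mem _
    · exact ⟨0, H.zero_mem, by rw [S.ord_algebraMap c hc]; simp⟩
  | add x y _ _ hx hy => rw [map_add]; exact add_mem hx hy
  | mul x y _ _ hx hy => rw [map_mul]; exact mul_mem hx hy

lemma algebraMap_mem_boundedSubring_of_isIntegral (H : AddSubmonoid 𝓡) {Γ : Submodule ℚ 𝓡}
    (hH : ∀ γ ∈ Γ, γ ∈ H) {p : P} (hp : IsIntegral (S.laurent Γ) p) :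
    algebraMap P 𝕃 p ∈ S.ord.boundedSubring H := by
  obtain ⟨f, hf, hfp⟩ := hp
  have := congrArg (algebraMap P 𝕃) hfp
  rw [hom_eval₂, map_zero, eval₂_eq_eval_map] at this
  refine ValuationSubring.mem_of_monic _ (hf.map _) (fun i => ?_) this
  rw [coeff_map]
  exact S.algebraMap_mem_boundedSubring H hH (f.coeff i).2

/-- The field of fractions of `S.laurent Γ`. -/
def ratField (Γ : Submodule ℚ 𝓡) : IntermediateField K 𝕃 :=
  IntermediateField.adjoin K (algebraMap P 𝕃 '' S.monomials Γ)

lemma laurent_map (Γ : Submodule ℚ 𝓡) :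
    (S.laurent Γ).map (IsScalarTower.toAlgHom K P 𝕃) =
      Algebra.adjoin K (algebraMap P 𝕃 '' S.monomials Γ) :=
  AlgHom.map_adjoin _ _

lemma algebraMap_mem_ratField {Γ : Submodule ℚ 𝓡} {p : P} (hp : p ∈ S.laurent Γ) :
    algebraMap P 𝕃 p ∈ S.ratField Γ := by
  refine IntermediateField.algebra_adjoin_le_adjoin K _ ?_
  rw [← S.laurent_map]
  exact ⟨p, hp, rfl⟩

lemma exists_eq_div_of_mem_ratField {Γ : Submodule ℚ 𝓡} {x : 𝕃} (hx : x ∈ S.ratField Γ) :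
    ∃ a ∈ S.laurent Γ, ∃ b ∈ S.laurent Γ, b ≠ 0 ∧ x = algebraMap P 𝕃 a / algebraMap P 𝕃 b := by
  obtain ⟨r, hr, s, hs, rfl⟩ := IntermediateField.mem_adjoin_iff_div.mp hx
  rw [← S.laurent_map] at hr hs
  obtain ⟨a, ha, rfl⟩ := hr
  obtain ⟨b, hb, rfl⟩ := hs
  by_cases hb0 : b = 0
  · refine ⟨0, zero_mem _, 1, one_mem _, ?_, ?_⟩
    · rintro h
      exact one_ne_zero (α := 𝕃) (by rw [← map_one (algebraMap P 𝕃), h, map_zero])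
    · simp [hb0]
  · exact ⟨a, ha, b, hb, hb0, rfl⟩

lemma θ_mem_ratField {Γ : Submodule ℚ 𝓡} : ∀ x ∈ S.ratField Γ, S.θ x ∈ S.ratField Γ := by
  intro x hx
  refine derivation_mem_adjoin (IntermediateField.subset_adjoin K _) ?_ hx
  rintro _ ⟨_, ⟨γ, hγ, rfl⟩, rfl⟩
  rw [S.θ_mono]
  exact (S.ratField Γ).smul_mem (S.algebraMap_mem_ratField (S.mono_mem_laurent hγ))

lemma ratField_subset_boundedSubring (H : AddSubmonoid 𝓡) {Γ : Submodule ℚ 𝓡}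
    (hH : ∀ γ ∈ Γ, γ ∈ H) {x : 𝕃} (hx : x ∈ S.ratField Γ) : x ∈ S.ord.boundedSubring H := by
  obtain ⟨a, ha, b, hb, hb0, rfl⟩ := S.exists_eq_div_of_mem_ratField hx
  rw [div_eq_mul_inv]
  refine mul_mem (S.algebraMap_mem_boundedSubring H hH ha) ?_
  obtain ⟨e, he, hle⟩ := S.algebraMap_mem_boundedSubring H hH (S.flip_mem_laurent hb)
  refine ⟨e, he, ?_⟩
  have h₁ := S.ord_add_ord_flip_nonpos b hb0
  have h₂ : S.ord (algebraMap P 𝕃 b) ≠ ⊤ :=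
    S.ord.ne_top_iff.mpr ((map_ne_zero_iff _ S.algebraMap_injective).mpr hb0)
  rw [AddValuation.map_inv]
  generalize S.ord (algebraMap P 𝕃 b) = u at *
  generalize S.ord (algebraMap P 𝕃 (S.flip b)) = v at *
  lift u to 𝓡 using h₂
  cases v with
  | top => simp at h₁
  | coe v =>
    rw [← WithTop.LinearOrderedAddCommGroup.coe_neg, WithTop.coe_le_coe]
    rw [WithTop.coe_le_coe] at hle
    have : u + v ≤ 0 := by exact_mod_cast h₁
    linarith

lemma algebraicClosure_subset_boundedSubring (H : AddSubmonoid 𝓡) {Γ : Submodule ℚ 𝓡}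
    (hH : ∀ γ ∈ Γ, γ ∈ H) {x : 𝕃} (hx : x ∈ algebraicClosure (S.ratField Γ) 𝕃) :
    x ∈ S.ord.boundedSubring H :=
  ValuationSubring.mem_of_isAlgebraic _
    (fun y : S.ratField Γ => S.ratField_subset_boundedSubring H hH y.2)
    (mem_algebraicClosure_iff.mp hx)

end SparseModel

end SparseModel

section SparseModel

namespace SparseModel

variable {𝓡 K P 𝕃 : Type*} [Field 𝓡] [LinearOrder 𝓡] [IsStrictOrderedRing 𝓡]
    [Field K] [CommRing P] [Field 𝕃] [Algebra K P] [Algebra K 𝕃] [Algebra P 𝕃]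
    [IsScalarTower K P 𝕃] (S : SparseModel 𝓡 K P 𝕃)

lemma ord_smul_mono {c : K} (hc : c ≠ 0) (γ : 𝓡) :
    S.ord (c • algebraMap P 𝕃 (S.mono (.ofAdd γ))) = γ := by
  rw [Algebra.smul_def, AddValuation.map_mul, S.ord_algebraMap c hc, S.ord_mono, zero_add]

lemma le_ord_smul_mono (c : K) (γ : 𝓡) :
    (γ : WithTop 𝓡) ≤ S.ord (c • algebraMap P 𝕃 (S.mono (.ofAdd γ))) := by
  by_cases hc : c = 0
  · simp [hc]
  · exact (S.ord_smul_mono hc γ).ge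

lemma ord_le_ord_iterate_θ (h : 𝕃) (i : ℕ) : S.ord h ≤ S.ord (S.θ^[i] h) := by
  induction i with
  | zero => rfl
  | succ i ih =>
    rw [Function.iterate_succ_apply']
    exact ih.trans (S.ord_le_ord_θ _)

lemma iterate_θ_smul_mono (c : K) (γ : 𝓡) (i : ℕ) :
    S.θ^[i] (c • algebraMap P 𝕃 (S.mono (.ofAdd γ))) =
      (S.κ γ ^ i * c) • algebraMap P 𝕃 (S.mono (.ofAdd γ)) := by
  induction i with
  | zero => simp
  | succ i ih =>
    rw [Function.iterate_succ_apply', ih, Derivation.map_smul, S.θ_mono, smul_smul]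
    congr 1
    ring

/-- The valuations of the solutions of a linear differential equation belong to a finite set. -/
lemma finite_ord_solutions {n : ℕ} (q : Fin n → 𝕃) (hq : q ≠ 0) :
    ∃ Z : Set 𝓡, Z.Finite ∧ ∀ h : 𝕃, h ≠ 0 → ∑ i, q i * (S.θ^[i] h) = 0 →
      ∃ γ ∈ Z, S.ord h = γ := by
  classical
  obtain ⟨i₁, hi₁⟩ : ∃ i, q i ≠ 0 := by
    by_contra! h
    exact hq (funext h)
  obtain ⟨i₀, -, hi₀⟩ := Finset.exists_min_image Finset.univ (fun i => S.ord (q i))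
    ⟨i₁, Finset.mem_univ _⟩
  have hqi₀ : q i₀ ≠ 0 := by
    intro h
    have := hi₀ i₁ (Finset.mem_univ _)
    simp only [h, AddValuation.map_zero, top_le_iff] at this
    exact S.ord.ne_top_iff.mpr hi₁ this
  obtain ⟨c₀, μ, hc₀, hμ, hlead₀⟩ := S.exists_leading (q i₀) hqi₀
  have hex : ∀ i, ∃ c : K,
      (μ : WithTop 𝓡) < S.ord (q i - c • algebraMap P 𝕃 (S.mono (.ofAdd μ))) := by
    intro i
    have hle : (μ : WithTop 𝓡) ≤ S.ord (q i) := hμ ▸ hi₀ i (Finset.mem_univ _)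
    rcases hle.eq_or_lt with h | h
    · have hqi : q i ≠ 0 := S.ord.ne_top_iff.mp (h ▸ WithTop.coe_ne_top)
      obtain ⟨c, γ, -, hγ, hlead⟩ := S.exists_leading (q i) hqi
      obtain rfl : μ = γ := by exact_mod_cast h.trans hγ
      exact ⟨c, hlead⟩
    · exact ⟨0, by simpa using h⟩
  choose c hc using hex
  have hci₀ : c i₀ ≠ 0 := by
    intro h
    have := hc i₀
    rw [h, zero_smul, sub_zero, hμ] at this
    exact lt_irrefl _ this
  let χ : K[X] := ∑ i : Fin n, Polynomial.monomial (i : ℕ) (c i)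
  have hχ : χ ≠ 0 := by
    intro h
    have := congrArg (fun f => f.coeff (i₀ : ℕ)) h
    simp [χ, coeff_monomial, Fin.val_inj] at this
    exact hci₀ this
  refine ⟨{γ | χ.IsRoot (S.κ γ)}, ?_, ?_⟩
  · exact (Polynomial.finite_setOfPred_isRoot hχ).preimage S.κ_injective.injOn
  · intro h h0 hsol
    obtain ⟨a, γ, ha, hγ, hlead⟩ := S.exists_leading h h0
    refine ⟨γ, ?_, hγ⟩
    by_contra hroot
    have hroot' : χ.eval (S.κ γ) ≠ 0 := hroot
    set T : 𝓡 → 𝕃 := fun γ => algebraMap P 𝕃 (S.mono (.ofAdd γ)) with hT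
    have hTadd : ∀ x y, T (x + y) = T x * T y := fun x y => by
      simp [hT, ofAdd_add]
    have hmain : ((μ + γ : 𝓡) : WithTop 𝓡) <
        S.ord (∑ i, q i * (S.θ^[i] h) - (χ.eval (S.κ γ) * a) • T (μ + γ)) := by
      have hsplit : ∑ i, q i * (S.θ^[i] h) - (χ.eval (S.κ γ) * a) • T (μ + γ) =
          ∑ i : Fin n, ((q i - c i • T μ) * (S.θ^[i] h) +
            (c i • T μ) * (S.θ^[i] (h - a • T γ))) := by
        simp only [χ, eval_finsetSum, eval_monomial, Finset.sum_mul, Finset.sum_smul]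
        rw [← Finset.sum_sub_distrib]
        refine Finset.sum_congr rfl fun i _ => ?_
        rw [iterate_map_sub, S.iterate_θ_smul_mono a γ i, hTadd]
        simp only [Algebra.smul_def, map_mul, hT]
        ring
      rw [hsplit]
      refine AddValuation.map_lt_sum _ WithTop.coe_ne_top fun i _ =>
        AddValuation.map_lt_add _ ?_ ?_
      · rw [AddValuation.map_mul, WithTop.coe_add]
        exact WithTop.add_lt_add_of_lt_of_le WithTop.coe_ne_top (hc i)
          (hγ ▸ S.ord_le_ord_iterate_θ h i)
      · rw [AddValuation.map_mul, WithTop.coe_add]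
        exact WithTop.add_lt_add_of_le_of_lt WithTop.coe_ne_top (S.le_ord_smul_mono _ _)
          (hlead.trans_le (S.ord_le_ord_iterate_θ _ i))
    rw [hsol, zero_sub, AddValuation.map_neg,
      S.ord_smul_mono (mul_ne_zero hroot' ha)] at hmain
    exact lt_irrefl _ hmain

end SparseModel

end SparseModel

section Scale

/-- The decomposition of a finite-dimensional space `Γ` of exponents at its largest archimedean
scale. -/
structure ExponentScale {𝓡 : Type*} [Field 𝓡] [LinearOrder 𝓡] [IsStrictOrderedRing 𝓡]
    (Γ : Submodule ℚ 𝓡) where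
  N : 𝓡
  pos : 0 < N
  bound : ∀ γ ∈ Γ, ∃ n : ℕ, |γ| ≤ n * N
  s : Γ →ₗ[ℚ] ℝ
  ne_zero : s ≠ 0
  lt_of_lt : ∀ (γ : Γ) (q : ℚ), (q : ℝ) < s γ → q * N < γ
  gt_of_gt : ∀ (γ : Γ) (q : ℚ), s γ < q → (γ : 𝓡) < q * N
  w : LinearMap.range s →ₗ[ℚ] Γ
  s_w : ∀ δ, s (w δ) = δ

namespace ExponentScale

variable {𝓡 : Type*} [Field 𝓡] [LinearOrder 𝓡] [IsStrictOrderedRing 𝓡] {Γ : Submodule ℚ 𝓡}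

lemma nonempty [FiniteDimensional ℚ Γ] (hΓ : Γ ≠ ⊥) : Nonempty (ExponentScale Γ) := by
  obtain ⟨N, hN, hb, s, hs, h₁, h₂⟩ := exists_scale Γ hΓ
  obtain ⟨w, hw⟩ := s.rangeRestrict.exists_rightInverse_of_surjective s.range_rangeRestrict
  exact ⟨⟨N, hN, hb, s, hs, h₁, h₂, w,
    fun δ => congrArg Subtype.val (LinearMap.congr_fun hw δ)⟩⟩

variable (E : ExponentScale Γ)

/-- The exponents of smaller scale. -/
noncomputable def small : Submodule ℚ 𝓡 := (LinearMap.ker E.s).map Γ.subtype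

/-- The quotient of the exponents by those of smaller scale. -/
abbrev Quot : Type := LinearMap.range E.s

lemma small_le : E.small ≤ Γ := Submodule.map_subtype_le _ _

lemma finrank_small_lt [FiniteDimensional ℚ Γ] :
    Module.finrank ℚ E.small < Module.finrank ℚ Γ := by
  rw [small, Submodule.finrank_map_subtype_eq]
  refine Submodule.finrank_lt fun h => E.ne_zero (LinearMap.ker_eq_top.mp h)

lemma exists_nsmul_eq (γ : E.Quot) (n : ℕ) (hn : n ≠ 0) : ∃ γ', n • γ' = γ :=
  ⟨(n : ℚ)⁻¹ • γ, by
    rw [← Nat.cast_smul_eq_nsmul ℚ, smul_smul, mul_inv_cancel₀ (Nat.cast_ne_zero.mpr hn),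
      one_smul]⟩

instance : Nontrivial E.Quot :=
  Submodule.nontrivial_iff_ne_bot.mpr fun h => E.ne_zero (LinearMap.range_eq_bot.mp h)

/-- The elements that are infinitesimal with respect to `E.N`. -/
def infinitesimal : AddSubmonoid 𝓡 where
  carrier := {a | ∀ n : ℕ, n * a ≤ E.N}
  zero_mem' n := by simpa using E.pos.le
  add_mem' := by
    intro a b ha hb n
    have h₁ := ha (2 * n)
    have h₂ := hb (2 * n)
    push_cast at h₁ h₂
    linarith

/-- The elements bounded above by a multiple of `E.N`. -/
def bounded : AddSubmonoid 𝓡 where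
  carrier := {a | ∃ n : ℕ, a ≤ n * E.N}
  zero_mem' := ⟨0, by simp⟩
  add_mem' := by
    rintro a b ⟨m, hm⟩ ⟨n, hn⟩
    refine ⟨m + n, ?_⟩
    push_cast
    linarith

lemma mem_bounded {γ : 𝓡} (hγ : γ ∈ Γ) : γ ∈ E.bounded := by
  obtain ⟨n, hn⟩ := E.bound γ hγ
  exact ⟨n, (le_abs_self γ).trans hn⟩

lemma mem_infinitesimal {γ : 𝓡} (hγ : γ ∈ E.small) : γ ∈ E.infinitesimal := by
  obtain ⟨g, hg, rfl⟩ := hγ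
  intro n
  rcases Nat.eq_zero_or_pos n with rfl | hn
  · simpa using E.pos.le
  have hn' : (0 : 𝓡) < n := Nat.cast_pos.mpr hn
  have hq : E.s g < ((n : ℚ)⁻¹ : ℚ) := by
    rw [LinearMap.mem_ker.mp hg]
    push_cast
    positivity
  have := E.gt_of_gt g _ hq
  push_cast at this
  rw [inv_mul_eq_div, lt_div_iff₀ hn', mul_comm] at this
  exact this.le

lemma exists_small_add {γ : 𝓡} (hγ : γ ∈ Γ) :
    ∃ γ₀ ∈ E.small, ∃ δ, γ = γ₀ + E.w δ := by
  refine ⟨γ - E.w ⟨E.s ⟨γ, hγ⟩, ⟨_, rfl⟩⟩, ⟨⟨γ, hγ⟩ - E.w ⟨E.s ⟨γ, hγ⟩, ⟨_, rfl⟩⟩, ?_, rfl⟩,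
    _, (sub_add_cancel _ _).symm⟩
  rw [SetLike.mem_coe, LinearMap.mem_ker, map_sub, E.s_w, sub_self]

end ExponentScale

namespace SparseModel

variable {𝓡 K P 𝕃 : Type*} [Field 𝓡] [LinearOrder 𝓡] [IsStrictOrderedRing 𝓡]
    [Field K] [CommRing P] [Field 𝕃] [Algebra K P] [Algebra K 𝕃] [Algebra P 𝕃]
    [IsScalarTower K P 𝕃] (S : SparseModel 𝓡 K P 𝕃) {Γ : Submodule ℚ 𝓡} (E : ExponentScale Γ)

/-- The monomial with exponent `E.w δ`. -/
noncomputable def scaleMono : Multiplicative E.Quot →* P :=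
  S.mono.comp (AddMonoidHom.toMultiplicative (Γ.subtype ∘ₗ E.w).toAddMonoidHom)

/-- The monomial with exponent `E.w δ` as a series. -/
noncomputable def scaleMonoL : Multiplicative E.Quot →* 𝕃 :=
  (algebraMap P 𝕃).toMonoidHom.comp (S.scaleMono E)

lemma scaleMonoL_apply (δ : E.Quot) : S.scaleMonoL E (.ofAdd δ) =
    algebraMap P 𝕃 (S.mono (.ofAdd (E.w δ : 𝓡))) := rfl

/-- The coefficient field for expansions at the scale `E`. -/
noncomputable abbrev coeffField : IntermediateField (S.ratField E.small) 𝕃 :=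
  algebraicClosure (S.ratField E.small) 𝕃

lemma exists_ord_eq_of_mem_coeffField {φ : 𝕃} (hφ : φ ∈ S.coeffField E) (h0 : φ ≠ 0) :
    ∃ a : 𝓡, S.ord φ = a ∧ a ∈ E.infinitesimal ∧ -a ∈ E.infinitesimal := by
  obtain ⟨b, hb, hle⟩ := S.algebraicClosure_subset_boundedSubring E.infinitesimal
    (fun γ => E.mem_infinitesimal) hφ
  obtain ⟨c, hc, hle'⟩ := S.algebraicClosure_subset_boundedSubring E.infinitesimal
    (fun γ => E.mem_infinitesimal) (inv_mem hφ)
  have htop : S.ord φ ≠ ⊤ := S.ord.ne_top_iff.mpr h0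
  rw [AddValuation.map_inv] at hle'
  generalize S.ord φ = u at *
  lift u to 𝓡 using htop
  rw [← WithTop.LinearOrderedAddCommGroup.coe_neg] at hle'
  rw [WithTop.coe_le_coe] at hle hle'
  refine ⟨u, rfl, fun n => ?_, fun n => ?_⟩
  · exact le_trans (mul_le_mul_of_nonneg_left (by linarith) (Nat.cast_nonneg n)) (hc n)
  · exact le_trans (mul_le_mul_of_nonneg_left (by linarith) (Nat.cast_nonneg n)) (hb n)

lemma isCoarseScale : IsCoarseScale (S.coeffField E) S.ord (S.scaleMonoL E) E.N := by
  have hinf : ∀ a ∈ E.infinitesimal, ∀ ε : ℚ, 0 < ε → a ≤ ε * E.N := by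
    intro a ha ε hε
    obtain ⟨n, hn⟩ := exists_nat_gt ε⁻¹
    have hn0 : (0 : ℚ) < n := (inv_pos.mpr hε).trans hn
    have h₁ : (1 : ℚ) ≤ ε * n := by
      have := mul_lt_mul_of_pos_left hn hε
      rw [mul_inv_cancel₀ hε.ne'] at this
      exact this.le
    have h₂ : (1 : 𝓡) ≤ ε * n := by exact_mod_cast h₁
    have h₃ : (0 : 𝓡) < n := by exact_mod_cast hn0
    have h₄ := ha n
    have h₅ : (n : 𝓡) * a ≤ n * (ε * E.N) := by nlinarith [E.pos]
    exact le_of_mul_le_mul_left h₅ h₃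
  have hord : ∀ c : S.coeffField E, c ≠ 0 → ∀ δ : E.Quot, ∃ a : 𝓡, a ∈ E.infinitesimal ∧
      -a ∈ E.infinitesimal ∧
      S.ord (c • S.scaleMonoL E (.ofAdd δ)) = ((a + E.w δ : 𝓡) : WithTop 𝓡) := by
    intro c hc δ
    obtain ⟨a, ha, h₁, h₂⟩ := S.exists_ord_eq_of_mem_coeffField E c.2 (by simpa using hc)
    refine ⟨a, h₁, h₂, ?_⟩
    rw [Algebra.smul_def, AddValuation.map_mul, S.scaleMonoL_apply, S.ord_mono, WithTop.coe_add,
      ← ha]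
    rfl
  refine ⟨E.pos, fun c hc δ q hq => ?_, fun c hc δ q hq => ?_⟩
  · obtain ⟨a, h₁, h₂, ho⟩ := hord c hc δ
    rw [ho, WithTop.coe_lt_coe]
    obtain ⟨r, hr₁, hr₂⟩ := exists_rat_btwn hq
    have h₃ := E.lt_of_lt (E.w δ) r (by rw [E.s_w]; exact hr₂)
    have h₄ := hinf _ h₂ (r - q) (sub_pos.mpr (by exact_mod_cast hr₁))
    push_cast at h₄
    linarith
  · obtain ⟨a, h₁, h₂, ho⟩ := hord c hc δ
    rw [ho, WithTop.coe_lt_coe]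
    obtain ⟨r, hr₁, hr₂⟩ := exists_rat_btwn hq
    have h₃ := E.gt_of_gt (E.w δ) r (by rw [E.s_w]; exact hr₁)
    have h₄ := hinf _ h₁ (q - r) (sub_pos.mpr (by exact_mod_cast hr₂))
    push_cast at h₄
    linarith

end SparseModel

end Scale

section ScaleEval

namespace SparseModel

variable {𝓡 K P 𝕃 : Type*} [Field 𝓡] [LinearOrder 𝓡] [IsStrictOrderedRing 𝓡]
    [Field K] [CommRing P] [Field 𝕃] [Algebra K P] [Algebra K 𝕃] [Algebra P 𝕃]
    [IsScalarTower K P 𝕃] (S : SparseModel 𝓡 K P 𝕃) {Γ : Submodule ℚ 𝓡} (E : ExponentScale Γ)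

/-- The image of `S.laurent E.small` in the coefficient field. -/
noncomputable def coeffRing : Subring (S.coeffField E) :=
  ((S.laurent E.small).map (IsScalarTower.toAlgHom K P 𝕃)).toSubring.comap
    (algebraMap (S.coeffField E) 𝕃)

lemma exists_coeffRing_eq {p : P} (hp : p ∈ S.laurent E.small) :
    ∃ c : S.coeffRing E, ((c : S.coeffField E) : 𝕃) = algebraMap P 𝕃 p :=
  ⟨⟨algebraMap (S.ratField E.small) (S.coeffField E)
    ⟨algebraMap P 𝕃 p, S.algebraMap_mem_ratField hp⟩, ⟨p, hp, rfl⟩⟩, rfl⟩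

/-- Finite expansions at the scale `E`. -/
noncomputable abbrev scaleEval :
    AddMonoidAlgebra (S.coeffField E) E.Quot →ₐ[S.coeffField E] 𝕃 :=
  AddMonoidAlgebra.lift _ _ _ (S.scaleMonoL E)

/-- Finite expansions at the scale `E` with Laurent polynomial coefficients. -/
noncomputable def scaleEvalRing : AddMonoidAlgebra (S.coeffRing E) E.Quot →+* 𝕃 :=
  (S.scaleEval E).toRingHom.comp (AddMonoidAlgebra.mapRingHom _ (S.coeffRing E).subtype)

lemma scaleEvalRing_single (δ : E.Quot) (c : S.coeffRing E) :
    S.scaleEvalRing E (.single δ c) =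
      ((c : S.coeffField E) : 𝕃) * algebraMap P 𝕃 (S.mono (.ofAdd (E.w δ : 𝓡))) := by
  simp only [scaleEvalRing, RingHom.comp_apply, AddMonoidAlgebra.mapRingHom_single]
  exact (AddMonoidAlgebra.lift_single _ _ _).trans (Algebra.smul_def _ _)

lemma algebraMap_mem_range_scaleEvalRing {p : P} (hp : p ∈ S.laurent Γ) :
    algebraMap P 𝕃 p ∈ (S.scaleEvalRing E).range := by
  induction hp using Algebra.adjoin_induction with
  | mem x hx =>
    obtain ⟨γ, hγ, rfl⟩ := hx
    obtain ⟨γ₀, hγ₀, δ, rfl⟩ := E.exists_small_add hγ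
    obtain ⟨c, hc⟩ := S.exists_coeffRing_eq E (S.mono_mem_laurent hγ₀)
    exact ⟨.single δ c, by rw [scaleEvalRing_single, hc, ofAdd_add, map_mul, map_mul]⟩
  | algebraMap a =>
    obtain ⟨c, hc⟩ := S.exists_coeffRing_eq E ((S.laurent E.small).algebraMap_mem a)
    exact ⟨.single 0 c, by rw [scaleEvalRing_single, hc]; simp⟩
  | add x y _ _ hx hy => rw [map_add]; exact add_mem hx hy
  | mul x y _ _ hx hy => rw [map_mul]; exact mul_mem hx hy

lemma isIntegralElem_scaleEvalRing {G : P} (hG : IsIntegral (S.laurent Γ) G) :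
    (S.scaleEvalRing E).IsIntegralElem (algebraMap P 𝕃 G) := by
  obtain ⟨f, hf, hfG⟩ := hG
  have := congrArg (algebraMap P 𝕃) hfG
  rw [hom_eval₂, map_zero, eval₂_eq_eval_map] at this
  refine RingHom.isIntegralElem_of_coeff_mem _ (hf.map _) (fun i => ?_) this
  rw [coeff_map]
  exact S.algebraMap_mem_range_scaleEvalRing E (f.coeff i).2

lemma exists_ord_ge_of_isIntegral {G : P} (hG : IsIntegral (S.laurent Γ) G) :
    ∃ D : ℕ, ((-(D * E.N) : 𝓡) : WithTop 𝓡) ≤ S.ord (algebraMap P 𝕃 G) := by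
  obtain ⟨a, ⟨D, hD⟩, ha⟩ := S.algebraMap_mem_boundedSubring_of_isIntegral E.bounded
    (fun γ => E.mem_bounded) hG
  exact ⟨D, le_trans (WithTop.coe_le_coe.mpr (neg_le_neg hD)) ha⟩

lemma exists_scaleEval_approx [CharZero K] [IsAlgClosed 𝕃] {G : P}
    (hG : IsIntegral (S.laurent Γ) G) (M : ℕ) :
    ∃ b, ((M * E.N : 𝓡) : WithTop 𝓡) ≤ S.ord (algebraMap P 𝕃 G - S.scaleEval E b) := by
  obtain ⟨p, hp, hpG⟩ := S.isIntegralElem_scaleEvalRing E hG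
  obtain ⟨D, hD⟩ := S.exists_ord_ge_of_isIntegral E hG
  have : IsAlgClosed (S.coeffField E) :=
    (algebraicClosure.isAlgClosure (S.ratField E.small) 𝕃).isAlgClosed
  have : CharZero (S.coeffField E) := charZero_of_injective_algebraMap
    (algebraMap K (S.coeffField E)).injective
  refine (S.isCoarseScale E).exists_approx E.exists_nsmul_eq (hp.map
    (AddMonoidAlgebra.mapRingHom _ (S.coeffRing E).subtype)) ?_ hD M
  rw [eval₂_map]
  exact hpG

/-- The inverse of a nonzero element which is algebraic over the finite expansions has valuation
bounded below by a multiple of the scale. -/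
lemma exists_ord_sub_scaleEval_lt {G : P} (hG : IsIntegral (S.laurent Γ) G)
    {b : AddMonoidAlgebra (S.coeffField E) E.Quot}
    (hb : algebraMap P 𝕃 G - S.scaleEval E b ≠ 0) :
    ∃ n : ℕ, S.ord (algebraMap P 𝕃 G - S.scaleEval E b) < ((n * E.N : 𝓡) : WithTop 𝓡) := by
  let L₀ : Subfield 𝕃 := Subfield.closure (S.scaleEval E).range
  have hL₀ : ∀ b, S.scaleEval E b ∈ L₀ := fun b => Subfield.subset_closure ⟨b, rfl⟩
  have hunit : ∀ b, S.scaleEval E b ∈ S.ord.boundedSubring E.bounded ∧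
      (S.scaleEval E b)⁻¹ ∈ S.ord.boundedSubring E.bounded := by
    intro b
    by_cases hb0 : b = 0
    · rw [hb0, map_zero, inv_zero]
      exact ⟨zero_mem _, zero_mem _⟩
    obtain ⟨δ, hδ, -, ho⟩ := (S.isCoarseScale E).exists_ord_lift hb0
    obtain ⟨n, hn⟩ := exists_nat_gt |(RealEmbedding.toReal δ : ℝ)|
    have h₁ := (S.isCoarseScale E).lt_ord _ hδ δ (-n)
      (by push_cast; linarith [neg_abs_le (RealEmbedding.toReal δ : ℝ)])
    have h₂ := (S.isCoarseScale E).ord_lt _ hδ δ n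
      (by push_cast; linarith [le_abs_self (RealEmbedding.toReal δ : ℝ)])
    rw [← ho] at h₁ h₂
    refine ⟨⟨n * E.N, ⟨n, le_rfl⟩, ?_⟩, ⟨n * E.N, ⟨n, le_rfl⟩, ?_⟩⟩
    · exact le_of_eq_of_le (congrArg _ (by push_cast; ring)) h₁.le
    · rw [AddValuation.map_inv]
      revert h₂
      generalize S.ord (S.scaleEval E b) = u
      intro h₂
      lift u to 𝓡 using ne_top_of_lt h₂
      rw [← WithTop.LinearOrderedAddCommGroup.coe_neg]
      rw [WithTop.coe_lt_coe] at h₂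
      rw [WithTop.coe_le_coe]
      push_cast at h₂
      linarith
  have hL₀W : ∀ x : L₀, algebraMap L₀ 𝕃 x ∈ S.ord.boundedSubring E.bounded := by
    rintro ⟨x, hx⟩
    obtain ⟨y, hy, v, hv, rfl⟩ := Subfield.mem_closure_iff.mp hx
    have hcl : Subring.closure ((S.scaleEval E).range : Set 𝕃) =
        (S.scaleEval E).range.toSubring := Subring.closure_eq (S.scaleEval E).range.toSubring
    rw [hcl] at hy hv
    obtain ⟨y, rfl⟩ := hy
    obtain ⟨v, rfl⟩ := hv
    have := mul_mem (hunit y).1 (hunit v).2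
    rwa [← div_eq_mul_inv] at this
  have hGalg : IsIntegral L₀ (algebraMap P 𝕃 G) := by
    obtain ⟨p, hp, hpG⟩ := S.isIntegralElem_scaleEvalRing E hG
    refine ⟨p.map ((S.scaleEvalRing E).codRestrict L₀ fun x => hL₀ _), hp.map _, ?_⟩
    rw [eval₂_map]
    exact hpG
  have hr : IsAlgebraic L₀ (algebraMap P 𝕃 G - S.scaleEval E b) :=
    (hGalg.sub (isIntegral_algebraMap (x := (⟨_, hL₀ b⟩ : L₀)))).isAlgebraic
  obtain ⟨a, ⟨n, hn⟩, ha⟩ := ValuationSubring.mem_of_isAlgebraic _ hL₀W hr.inv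
  rw [AddValuation.map_inv] at ha
  have htop := S.ord.ne_top_iff.mpr hb
  revert htop ha
  generalize S.ord (algebraMap P 𝕃 G - S.scaleEval E b) = u
  intro ha htop
  lift u to 𝓡 using htop
  rw [← WithTop.LinearOrderedAddCommGroup.coe_neg, WithTop.coe_le_coe] at ha
  refine ⟨n + 1, ?_⟩
  rw [WithTop.coe_lt_coe]
  push_cast
  linarith [E.pos]

end SparseModel

end ScaleEval

section DiffOp

namespace SparseModel

variable {𝓡 K P 𝕃 : Type*} [Field 𝓡] [LinearOrder 𝓡] [IsStrictOrderedRing 𝓡]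
    [Field K] [CommRing P] [Field 𝕃] [Algebra K P] [Algebra K 𝕃] [Algebra P 𝕃]
    [IsScalarTower K P 𝕃] (S : SparseModel 𝓡 K P 𝕃) {Γ : Submodule ℚ 𝓡} (E : ExponentScale Γ)

/-- The linear differential operator with coefficients `q`. -/
noncomputable def diffOp {n : ℕ} (q : Fin n → P) : 𝕃 →ₗ[K] 𝕃 :=
  ∑ i, LinearMap.mulLeft K (algebraMap P 𝕃 (q i)) ∘ₗ (S.θ : 𝕃 →ₗ[K] 𝕃) ^ (i : ℕ)

lemma diffOp_apply {n : ℕ} (q : Fin n → P) (h : 𝕃) :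
    S.diffOp q h = ∑ i, algebraMap P 𝕃 (q i) * (S.θ^[i] h) := by
  simp [diffOp, LinearMap.sum_apply, Module.End.pow_apply]

variable {E}

lemma le_ord_mul_of_mem_laurent {q : P} (hq : q ∈ S.laurent E.small) {c : 𝓡} {h : 𝕃}
    (hc : (c : WithTop 𝓡) ≤ S.ord h) :
    ((c - E.N : 𝓡) : WithTop 𝓡) ≤ S.ord (algebraMap P 𝕃 q * h) := by
  obtain ⟨a, ha, hle⟩ := S.algebraMap_mem_boundedSubring E.infinitesimal
    (fun γ => E.mem_infinitesimal) hq
  have haN : a ≤ E.N := by simpa using ha 1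
  rw [AddValuation.map_mul, sub_eq_neg_add, WithTop.coe_add]
  exact add_le_add ((WithTop.coe_le_coe.mpr (neg_le_neg haN)).trans hle) hc

lemma le_ord_diffOp {n : ℕ} {q : Fin n → P} (hq : ∀ i, q i ∈ S.laurent E.small) {c : 𝓡} {h : 𝕃}
    (hc : (c : WithTop 𝓡) ≤ S.ord h) :
    ((c - E.N : 𝓡) : WithTop 𝓡) ≤ S.ord (S.diffOp q h) := by
  rw [diffOp_apply]
  exact S.ord.map_le_sum fun i _ =>
    S.le_ord_mul_of_mem_laurent (hq i) (hc.trans (S.ord_le_ord_iterate_θ h i))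

lemma scaleEval_apply (b : AddMonoidAlgebra (S.coeffField E) E.Quot) :
    S.scaleEval E b = ∑ δ ∈ b.coeff.support, b.coeff δ • S.scaleMonoL E (.ofAdd δ) := by
  rw [scaleEval, AddMonoidAlgebra.lift_apply]
  rfl

lemma isDFinite_scaleEval [CharZero K] (b : AddMonoidAlgebra (S.coeffField E) E.Quot) :
    IsDFinite S.θ (S.ratField E.small) (S.scaleEval E b) := by
  rw [scaleEval_apply]
  refine IsDFinite.sum _ fun δ _ => ?_
  rw [Algebra.smul_def]
  refine (IsDFinite.of_isAlgebraic S.θ_mem_ratField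
    (mem_algebraicClosure_iff.mp (b.coeff δ).2)).mul_right
    (a := algebraMap K _ (S.κ (E.w δ : 𝓡))) ?_
  rw [scaleMonoL_apply, S.θ_mono, Algebra.smul_def]
  rfl

lemma exists_diffOp_scaleEval_eq_zero [CharZero K]
    (b : AddMonoidAlgebra (S.coeffField E) E.Quot) :
    ∃ (n : ℕ) (q : Fin n → P), (∀ i, q i ∈ S.laurent E.small) ∧ q ≠ 0 ∧
      S.diffOp q (S.scaleEval E b) = 0 := by
  classical
  obtain ⟨n, q, hq0, hq⟩ := (S.isDFinite_scaleEval b).exists_sum_eq_zero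
  choose x hx y hy hy0 hxy using fun i => S.exists_eq_div_of_mem_ratField (q i).2
  have hy0' : ∀ i, algebraMap P 𝕃 (y i) ≠ 0 := fun i =>
    (map_ne_zero_iff _ S.algebraMap_injective).mpr (hy0 i)
  have key : ∀ i, algebraMap P 𝕃 (x i * ∏ j ∈ Finset.univ.erase i, y j) =
      (∏ j, algebraMap P 𝕃 (y j)) * (q i : 𝕃) := by
    intro i
    rw [hxy, map_mul, map_prod, ← Finset.mul_prod_erase _ _ (Finset.mem_univ i)]
    field_simp [hy0' i]
  refine ⟨n, fun i => x i * ∏ j ∈ Finset.univ.erase i, y j,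
    fun i => mul_mem (hx i) (prod_mem fun j _ => hy j), ?_, ?_⟩
  · intro h
    refine hq0 (funext fun i => ?_)
    have := key i
    rw [congrFun h i, Pi.zero_apply, map_zero, zero_eq_mul] at this
    exact Subtype.ext (this.resolve_left (Finset.prod_ne_zero_iff.mpr fun j _ => hy0' j))
  · rw [diffOp_apply]
    simp only [key, mul_assoc]
    rw [← Finset.mul_sum, hq, mul_zero]

lemma exists_iterate_θ (p : P) (i : ℕ) : ∃ p', algebraMap P 𝕃 p' = S.θ^[i] (algebraMap P 𝕃 p) ∧
    S.ord (algebraMap P 𝕃 (S.flip p)) ≤ S.ord (algebraMap P 𝕃 (S.flip p')) := by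
  induction i with
  | zero => exact ⟨p, rfl, le_rfl⟩
  | succ i ih =>
    obtain ⟨p', h₁, h₂⟩ := ih
    obtain ⟨p'', h₃, h₄⟩ := S.exists_θ p'
    exact ⟨p'', by rw [h₃, h₁, Function.iterate_succ_apply'], h₂.trans h₄⟩

/-- An integral element satisfies a linear differential equation with coefficients of small
exponents. -/
lemma exists_diffOp_eq_zero [CharZero K] [IsAlgClosed 𝕃] (E : ExponentScale Γ) {G : P}
    (hG : IsIntegral (S.laurent Γ) G) :
    ∃ (n : ℕ) (q : Fin n → P), (∀ i, q i ∈ S.laurent E.small) ∧ q ≠ 0 ∧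
      S.diffOp q (algebraMap P 𝕃 G) = 0 := by
  obtain ⟨D, hD⟩ := S.exists_ord_ge_of_isIntegral E (S.isIntegral_flip hG)
  obtain ⟨b, hb⟩ := S.exists_scaleEval_approx E hG (D + 3)
  obtain ⟨n, q, hq, hq0, hqb⟩ := S.exists_diffOp_scaleEval_eq_zero b
  choose p hp hflip using fun i => S.exists_iterate_θ G i
  refine ⟨n, q, hq, hq0, ?_⟩
  have hH : S.diffOp q (algebraMap P 𝕃 G) = algebraMap P 𝕃 (∑ i, q i * p i) := by
    rw [diffOp_apply, map_sum]
    exact Finset.sum_congr rfl fun i _ => by rw [map_mul, hp]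
  by_contra hne
  rw [hH] at hne
  have h₁ := S.ord_add_ord_flip_nonpos _ ((map_ne_zero_iff _ S.algebraMap_injective).mp hne)
  have h₂ := S.le_ord_diffOp hq hb
  rw [map_sub, hqb, sub_zero, hH] at h₂
  have h₃ : ((-(D * E.N) - E.N : 𝓡) : WithTop 𝓡) ≤
      S.ord (algebraMap P 𝕃 (S.flip (∑ i : Fin n, q i * p i))) := by
    rw [map_sum, map_sum]
    refine S.ord.map_le_sum fun i _ => ?_
    rw [map_mul, map_mul]
    exact S.le_ord_mul_of_mem_laurent (S.flip_mem_laurent (hq i)) (hD.trans (hflip i))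
  have h₄ := (add_le_add h₂ h₃).trans h₁
  rw [← WithTop.coe_add, ← WithTop.coe_zero, WithTop.coe_le_coe] at h₄
  push_cast at h₄
  linarith [E.pos]

lemma exists_diffOp_smul [CharZero K] {n : ℕ} {q : Fin n → P}
    (hq : ∀ i, q i ∈ S.laurent E.small) (δ : E.Quot) (φ : S.coeffField E) :
    ∃ φ' : S.coeffField E, S.diffOp q (φ • S.scaleMonoL E (.ofAdd δ)) =
      φ' • S.scaleMonoL E (.ofAdd δ) := by
  have hθ : ∀ i : ℕ, ∃ φ' : S.coeffField E,
      S.θ^[i] (φ • S.scaleMonoL E (.ofAdd δ)) = φ' • S.scaleMonoL E (.ofAdd δ) := by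
    intro i
    induction i with
    | zero => exact ⟨φ, rfl⟩
    | succ i ih =>
      obtain ⟨ψ, hψ⟩ := ih
      refine ⟨⟨S.θ ψ, derivation_mem_algebraicClosure S.θ_mem_ratField ψ.2⟩ +
        algebraMap (S.ratField E.small) _ (algebraMap K _ (S.κ (E.w δ : 𝓡))) * ψ, ?_⟩
      rw [Function.iterate_succ_apply', hψ, Algebra.smul_def, Algebra.smul_def,
        Derivation.leibniz, scaleMonoL_apply, S.θ_mono, map_add, map_mul, add_mul, add_comm]
      simp only [smul_eq_mul, Algebra.smul_def]
      congr 1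
      · exact mul_comm _ _
      · exact mul_left_comm _ _ _ |>.trans (mul_assoc _ _ _).symm
  choose ψ hψ using hθ
  refine ⟨∑ i : Fin n, algebraMap (S.ratField E.small) _
    ⟨_, S.algebraMap_mem_ratField (hq i)⟩ * ψ i, ?_⟩
  rw [diffOp_apply, Finset.sum_smul]
  refine Finset.sum_congr rfl fun i _ => ?_
  rw [hψ, mul_smul, Algebra.smul_def (algebraMap _ _ _)]
  rfl

lemma exists_scaleEval_approx_of_diffOp_eq_zero [CharZero K] [IsAlgClosed 𝕃] {G : P}
    (hG : IsIntegral (S.laurent Γ) G) {n : ℕ} {q : Fin n → P}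
    (hq : ∀ i, q i ∈ S.laurent E.small) (hqG : S.diffOp q (algebraMap P 𝕃 G) = 0) (M : ℕ) :
    ∃ b, ((M * E.N : 𝓡) : WithTop 𝓡) ≤ S.ord (algebraMap P 𝕃 G - S.scaleEval E b) ∧
      S.diffOp q (algebraMap P 𝕃 G - S.scaleEval E b) = 0 := by
  classical
  obtain ⟨b, hb⟩ := S.exists_scaleEval_approx E hG (M + 2)
  choose A hA using fun δ => S.exists_diffOp_smul hq δ
  set T := b.coeff.support with hT
  have hsingle : ∀ (T' : Finset E.Quot) (f : E.Quot → S.coeffField E),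
      S.scaleEval E (∑ δ ∈ T', .single δ (f δ)) = ∑ δ ∈ T', f δ • S.scaleMonoL E (.ofAdd δ) := by
    intro T' f
    rw [map_sum]
    exact Finset.sum_congr rfl fun δ _ => AddMonoidAlgebra.lift_single _ _ _
  have hcoeff : ∀ (T' : Finset E.Quot) (f : E.Quot → S.coeffField E) (δ : E.Quot),
      (∑ δ ∈ T', AddMonoidAlgebra.single δ (f δ)).coeff δ = if δ ∈ T' then f δ else 0 := by
    intro T' f δ
    simp [AddMonoidAlgebra.coeff_sum, Finsupp.single_apply]
  have hA0 : ∀ δ ∈ T, (RealEmbedding.toReal δ : ℝ) < (M + 1 : ℕ) → A δ (b.coeff δ) = 0 := by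
    intro δ hδ hlt
    have h₁ : S.scaleEval E (∑ δ ∈ T, .single δ (A δ (b.coeff δ))) =
        - S.diffOp q (algebraMap P 𝕃 G - S.scaleEval E b) := by
      rw [hsingle, map_sub, hqG, zero_sub, neg_neg, scaleEval_apply, map_sum]
      exact Finset.sum_congr rfl fun δ _ => (hA δ _).symm
    have h₂ : (((M + 1 : ℕ) : ℚ) * E.N : 𝓡) ≤
        S.ord (S.scaleEval E (∑ δ ∈ T, .single δ (A δ (b.coeff δ)))) := by
      rw [h₁, AddValuation.map_neg]
      refine le_of_eq_of_le (congrArg _ ?_) (S.le_ord_diffOp hq hb)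
      push_cast
      ring
    have := (S.isCoarseScale E).coeff_eq_zero h₂ (by exact_mod_cast hlt)
    rwa [hcoeff, if_pos hδ] at this
  set T₁ := T.filter fun δ => (RealEmbedding.toReal δ : ℝ) < (M + 1 : ℕ) with hT₁
  set b₁ := ∑ δ ∈ T₁, AddMonoidAlgebra.single δ (b.coeff δ) with hb₁
  have h₁ : S.diffOp q (S.scaleEval E b₁) = 0 := by
    rw [hsingle, map_sum]
    refine Finset.sum_eq_zero fun δ hδ => ?_
    obtain ⟨hδT, hlt⟩ := Finset.mem_filter.mp hδ
    rw [hA, hA0 δ hδT hlt, zero_smul]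
  refine ⟨b₁, ?_, by rw [map_sub, hqG, h₁, sub_zero]⟩
  have h₂ : (((M : ℚ) * E.N : 𝓡) : WithTop 𝓡) ≤ S.ord (S.scaleEval E (b - b₁)) := by
    refine (S.isCoarseScale E).le_ord_lift (M := (M + 1 : ℕ)) (fun δ hδ => ?_)
      (by push_cast; linarith)
    rw [AddMonoidAlgebra.coeff_sub, Finsupp.sub_apply, hb₁, hcoeff]
    by_cases hδT : δ ∈ T
    · rw [if_pos (Finset.mem_filter.mpr ⟨hδT, hδ⟩), sub_self]
    · rw [if_neg fun h => hδT (Finset.mem_filter.mp h).1, sub_zero]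
      simpa [hT] using hδT
  rw [show algebraMap P 𝕃 G - S.scaleEval E b₁ =
    (algebraMap P 𝕃 G - S.scaleEval E b) + S.scaleEval E (b - b₁) by rw [map_sub]; ring]
  refine AddValuation.map_le_add _ (le_trans ?_ hb) (by exact_mod_cast h₂)
  rw [WithTop.coe_le_coe]
  push_cast
  nlinarith [E.pos]

/-- Every integral element is a finite expansion. -/
lemma exists_scaleEval_eq [CharZero K] [IsAlgClosed 𝕃] (E : ExponentScale Γ) {G : P}
    (hG : IsIntegral (S.laurent Γ) G) : ∃ b, algebraMap P 𝕃 G = S.scaleEval E b := by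
  obtain ⟨n, q, hq, hq0, hqG⟩ := S.exists_diffOp_eq_zero E hG
  obtain ⟨Z, hZ, hsol⟩ := S.finite_ord_solutions (fun i => algebraMap P 𝕃 (q i)) fun h =>
    hq0 (funext fun i => (map_eq_zero_iff _ S.algebraMap_injective).mp (congrFun h i))
  have hm : ∀ γ : 𝓡, ∃ m : ℕ, ∀ b, S.ord (algebraMap P 𝕃 G - S.scaleEval E b) = γ →
      γ < m * E.N := by
    intro γ
    by_cases h : ∃ b, S.ord (algebraMap P 𝕃 G - S.scaleEval E b) = γ
    · obtain ⟨b, hb⟩ := h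
      obtain ⟨m, hm⟩ := S.exists_ord_sub_scaleEval_lt E hG (b := b)
        (S.ord.ne_top_iff.mp (hb ▸ WithTop.coe_ne_top))
      rw [hb, WithTop.coe_lt_coe] at hm
      exact ⟨m, fun _ _ => hm⟩
    · exact ⟨0, fun b hb => absurd ⟨b, hb⟩ h⟩
  choose m hm using hm
  obtain ⟨M, hM⟩ := (hZ.image m).bddAbove
  obtain ⟨b, hb, hqb⟩ := S.exists_scaleEval_approx_of_diffOp_eq_zero hG hq hqG M
  refine ⟨b, ?_⟩
  by_contra hne
  obtain ⟨γ, hγZ, hγ⟩ := hsol _ (sub_ne_zero.mpr hne) (by rw [← diffOp_apply, hqb])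
  have h₁ := hm γ b hγ
  rw [hγ, WithTop.coe_le_coe] at hb
  have h₂ : (m γ : 𝓡) ≤ M := Nat.cast_le.mpr (hM ⟨γ, hγZ, rfl⟩)
  nlinarith [E.pos]

end SparseModel

end DiffOp

section Descent

namespace SparseModel

variable {𝓡 K P 𝕃 : Type*} [Field 𝓡] [LinearOrder 𝓡] [IsStrictOrderedRing 𝓡]
    [Field K] [CommRing P] [Field 𝕃] [Algebra K P] [Algebra K 𝕃] [Algebra P 𝕃]
    [IsScalarTower K P 𝕃] (S : SparseModel 𝓡 K P 𝕃) {Γ : Submodule ℚ 𝓡} {E : ExponentScale Γ}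

lemma isIntegral_coeff_of_eq_scaleEval {G : P} (hG : IsIntegral (S.laurent Γ) G)
    {b : AddMonoidAlgebra (S.coeffField E) E.Quot} (hb : algebraMap P 𝕃 G = S.scaleEval E b)
    (δ : E.Quot) : IsIntegral (S.laurent E.small) ((b.coeff δ : S.coeffField E) : 𝕃) := by
  obtain ⟨p, hp, hpG⟩ := S.isIntegralElem_scaleEvalRing E hG
  have hinteg : (AddMonoidAlgebra.mapRingHom E.Quot (S.coeffRing E).subtype).IsIntegralElem b := by
    refine ⟨p, hp, (S.isCoarseScale E).lift_injective ?_⟩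
    rw [hb] at hpG
    rw [map_zero, ← hpG]
    exact hom_eval₂ p _ (S.scaleEval E).toRingHom b
  obtain ⟨r, hr, hrδ⟩ := isIntegral_coeff_of_isIntegralElem (S.coeffRing E) b hinteg δ
  have := congrArg (algebraMap (S.coeffField E) 𝕃) hrδ
  rw [hom_eval₂, map_zero, eval₂_eq_eval_map] at this
  refine RingHom.isIntegralElem_of_coeff_mem _ (hr.map _) (fun i => ?_) this
  rw [coeff_map]
  obtain ⟨x, hx, hxr⟩ := (r.coeff i).2
  exact ⟨⟨x, hx⟩, hxr⟩

lemma exists_sum_scaleMono_mul [CharZero K] [IsAlgClosed 𝕃] [IsDomain P] [IsIntegrallyClosed P]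
    (E : ExponentScale Γ) {G : P} (hG : IsIntegral (S.laurent Γ) G) :
    ∃ (s : Finset E.Quot) (ψ : E.Quot → P), (∀ δ ∈ s, IsIntegral (S.laurent E.small) (ψ δ)) ∧
      G = ∑ δ ∈ s, S.scaleMono E (.ofAdd δ) * ψ δ := by
  obtain ⟨b, hb⟩ := S.exists_scaleEval_eq E hG
  let Q := FractionRing P
  let _ : Algebra Q 𝕃 := (IsFractionRing.lift S.algebraMap_injective).toAlgebra
  have hPQ : ∀ p : P, algebraMap Q 𝕃 (algebraMap P Q p) = algebraMap P 𝕃 p := fun p =>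
    IsFractionRing.lift_algebraMap S.algebraMap_injective p
  have : IsScalarTower (S.laurent E.small) Q 𝕃 := .of_algebraMap_eq fun x => (hPQ x).symm
  have : IsScalarTower (S.laurent E.small) P Q := .of_algebraMap_eq fun x => rfl
  have : CharZero P := charZero_of_injective_algebraMap (algebraMap K P).injective
  have : CharZero Q := charZero_of_injective_algebraMap (IsFractionRing.injective P Q)
  obtain ⟨ψ, hψ, hGψ⟩ := exists_isIntegral_sum_eq (R := S.laurent E.small) (M := Q)
    b.coeff.support (fun δ => ((b.coeff δ : S.coeffField E) : 𝕃))
    (fun δ _ => S.isIntegral_coeff_of_eq_scaleEval hG hb δ)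
    (fun δ => algebraMap P Q (S.scaleMono E (.ofAdd δ))) (algebraMap P Q G) (by
      rw [hPQ, hb, scaleEval_apply]
      refine Finset.sum_congr rfl fun δ _ => ?_
      rw [hPQ, Algebra.smul_def, mul_comm]
      rfl)
  have hψ' : ∀ δ ∈ b.coeff.support, IsIntegral (S.laurent E.small) (ψ δ) := by
    intro δ hδ
    obtain ⟨n, hn, hinteg⟩ := hψ δ hδ
    have h := (isIntegral_algebraMap (R := S.laurent E.small) (A := Q)
      (x := algebraMap K (S.laurent E.small) (n : K)⁻¹)).mul hinteg
    have hone : algebraMap (S.laurent E.small) Q (algebraMap K (S.laurent E.small) (n : K)⁻¹) *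
        (n : Q) = 1 := by
      rw [← map_natCast (algebraMap (S.laurent E.small) Q), ← map_mul,
        ← map_natCast (algebraMap K (S.laurent E.small)), ← map_mul,
        inv_mul_cancel₀ (Nat.cast_ne_zero.mpr hn), map_one, map_one]
    rwa [← mul_assoc, hone, one_mul] at h
  have hex : ∀ δ, ∃ y : P, δ ∈ b.coeff.support → algebraMap P Q y = ψ δ := by
    intro δ
    by_cases hδ : δ ∈ b.coeff.support
    · obtain ⟨y, hy⟩ := IsIntegrallyClosed.isIntegral_iff.mp ((hψ' δ hδ).tower_top (A := P))
      exact ⟨y, fun _ => hy⟩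
    · exact ⟨0, fun h => absurd h hδ⟩
  choose y hy using hex
  refine ⟨b.coeff.support, y, fun δ hδ => ?_, IsFractionRing.injective P Q ?_⟩
  · rw [← isIntegral_algebraMap_iff (IsFractionRing.injective P Q), hy δ hδ]
    exact hψ' δ hδ
  · rw [hGψ, map_sum]
    exact Finset.sum_congr rfl fun δ hδ => by rw [map_mul, hy δ hδ]

lemma mem_range_of_isIntegral_laurent_bot [IsAlgClosed K] {G : P}
    (hG : IsIntegral (S.laurent ⊥) G) : ∃ c, algebraMap K P c = G := by
  have hbot : S.laurent ⊥ = ⊥ := by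
    rw [eq_bot_iff]
    refine Algebra.adjoin_le ?_
    rintro _ ⟨γ, hγ, rfl⟩
    rw [(Submodule.mem_bot ℚ).mp hγ, ofAdd_zero, map_one]
    exact one_mem _
  obtain ⟨f, hf, hfG⟩ := hG
  have := congrArg (algebraMap P 𝕃) hfG
  rw [hom_eval₂, map_zero, eval₂_eq_eval_map] at this
  have hinteg : IsIntegral K (algebraMap P 𝕃 G) := by
    refine RingHom.isIntegralElem_of_coeff_mem _ (hf.map _) (fun i => ?_) this
    have hfi : (f.coeff i : P) ∈ (⊥ : Subalgebra K P) := hbot.le (f.coeff i).2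
    obtain ⟨c, hc⟩ := Algebra.mem_bot.mp hfi
    rw [coeff_map]
    refine ⟨c, ?_⟩
    rw [IsScalarTower.algebraMap_apply K P 𝕃, hc]
    rfl
  obtain ⟨c, hc⟩ := minpoly.mem_range_of_degree_eq_one K (algebraMap P 𝕃 G)
    (IsAlgClosed.degree_eq_one_of_irreducible K (minpoly.irreducible hinteg))
  exact ⟨c, S.algebraMap_injective (by rw [← IsScalarTower.algebraMap_apply, hc])⟩

/-- Laurent polynomials with exponents in a finite-dimensional space are integrally closed among
sparse Laurent polynomials, up to enlarging the set of exponents. -/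
theorem mem_laurent_top_of_isIntegral [CharZero K] [IsAlgClosed K] [IsAlgClosed 𝕃] [IsDomain P]
    [IsIntegrallyClosed P] (Γ : Submodule ℚ 𝓡) [FiniteDimensional ℚ Γ] {G : P}
    (hG : IsIntegral (S.laurent Γ) G) : G ∈ S.laurent ⊤ := by
  induction hn : Module.finrank ℚ Γ using Nat.strong_induction_on generalizing Γ G with
  | _ n ih =>
  by_cases hΓ : Γ = ⊥
  · subst hΓ
    obtain ⟨c, rfl⟩ := S.mem_range_of_isIntegral_laurent_bot hG
    exact (S.laurent ⊤).algebraMap_mem c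
  obtain ⟨E⟩ := ExponentScale.nonempty hΓ
  have : FiniteDimensional ℚ E.small := Submodule.finiteDimensional_of_le E.small_le
  obtain ⟨s, ψ, hψ, rfl⟩ := S.exists_sum_scaleMono_mul E hG
  exact sum_mem fun δ hδ => mul_mem (S.mono_mem_laurent Submodule.mem_top)
    (ih _ (hn ▸ E.finrank_small_lt) E.small (hψ δ hδ) rfl)

end SparseModel

end Descent

section EulerDerivation

variable {F : Type*} [Field F]

/-- The operator `t d/dt` on Hahn series with rational exponents. -/
noncomputable def hahnEuler (x : HahnSeries ℚ F) : HahnSeries ℚ F :=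
  ⟨fun q => q * x.coeff q, x.isPWO_support.mono fun _ hq h => hq (mul_eq_zero_of_right _ h)⟩

@[simp] lemma coeff_hahnEuler (x : HahnSeries ℚ F) (q : ℚ) :
    (hahnEuler x).coeff q = q * x.coeff q := rfl

lemma hahnEuler_add (x y : HahnSeries ℚ F) :
    hahnEuler (x + y) = hahnEuler x + hahnEuler y := by
  ext q
  simp [mul_add]

lemma hahnEuler_single (q : ℚ) (c : F) :
    hahnEuler (HahnSeries.single q c) = HahnSeries.single q (q * c) := by
  ext r
  simp only [coeff_hahnEuler, HahnSeries.coeff_single]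
  split_ifs with h
  · rw [h]
  · rw [mul_zero]

lemma hahnEuler_mul [CharZero F] (x y : HahnSeries ℚ F) :
    hahnEuler (x * y) = x * hahnEuler y + y * hahnEuler x := by
  ext q
  have hx : (hahnEuler x).support ⊆ x.support := fun q hq h => hq (by simp [h])
  have hy : (hahnEuler y).support ⊆ y.support := fun q hq h => hq (by simp [h])
  rw [HahnSeries.coeff_add, coeff_hahnEuler, HahnSeries.coeff_mul,
    HahnSeries.coeff_mul_right' y.isPWO_support hy, mul_comm y,
    HahnSeries.coeff_mul_left' x.isPWO_support hx, Finset.mul_sum, ← Finset.sum_add_distrib]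
  refine Finset.sum_congr rfl fun ij hij => ?_
  rw [← (Finset.mem_antidiagonal.mp hij).2.2]
  simp only [coeff_hahnEuler]
  push_cast
  ring

/-- The operator `t d/dt` on the group algebra. -/
noncomputable def groupAlgebraEuler (p : AddMonoidAlgebra F ℚ) : AddMonoidAlgebra F ℚ :=
  .ofCoeff (Finsupp.onFinset p.coeff.support (fun q => q * p.coeff q) fun q hq => by
    simp at hq ⊢; exact hq.2)

lemma toHahn_groupAlgebraEuler (p : AddMonoidAlgebra F ℚ) :
    toHahn ℚ F (groupAlgebraEuler p) = hahnEuler (toHahn ℚ F p) := by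
  ext q
  simp [coeff_toHahn, groupAlgebraEuler]

variable (F) in
/-- The involution of the group algebra replacing the variable by its inverse. -/
noncomputable def groupAlgebraFlip : AddMonoidAlgebra F ℚ →ₐ[F] AddMonoidAlgebra F ℚ :=
  AddMonoidAlgebra.mapDomainAlgHom F F (-AddMonoidHom.id ℚ)

lemma coeff_groupAlgebraFlip (p : AddMonoidAlgebra F ℚ) (q : ℚ) :
    (groupAlgebraFlip F p).coeff q = p.coeff (-q) := by
  rw [← neg_neg q]
  exact (Finsupp.mapDomain_apply neg_injective _ _).trans (by rw [neg_neg])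

lemma order_toHahn_add_order_flip_nonpos {p : AddMonoidAlgebra F ℚ} (hp : p ≠ 0) :
    (toHahn ℚ F p).order + (toHahn ℚ F (groupAlgebraFlip F p)).order ≤ 0 := by
  obtain ⟨q, hq⟩ : ∃ q, p.coeff q ≠ 0 := by
    by_contra! h
    exact hp (AddMonoidAlgebra.coeff_injective (Finsupp.ext h))
  have h₁ := HahnSeries.order_le_of_coeff_ne_zero (x := toHahn ℚ F p) (g := q)
    (by rwa [coeff_toHahn])
  have h₂ := HahnSeries.order_le_of_coeff_ne_zero (x := toHahn ℚ F (groupAlgebraFlip F p))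
    (g := -q) (by rwa [coeff_toHahn, coeff_groupAlgebraFlip, neg_neg])
  linarith

lemma HahnSeries.order_le_order_of_support_subset {x y : HahnSeries ℚ F}
    (h : ∀ q, x.coeff q = 0 → y.coeff q = 0) (hy : y ≠ 0) : x.order ≤ y.order :=
  order_le_of_coeff_ne_zero fun h0 => hy (coeff_order_eq_zero.mp (h _ h0))

lemma HahnSeries.order_lt_order_sub_single {x : HahnSeries ℚ F}
    (hx : x - single x.order (x.coeff x.order) ≠ 0) :
    x.order < (x - single x.order (x.coeff x.order)).order := by
  refine lt_of_not_ge fun h => coeff_order_eq_zero.not.mpr hx ?_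
  rw [coeff_sub, coeff_single]
  rcases h.lt_or_eq with h | h
  · rw [if_neg h.ne, coeff_eq_zero_of_lt_order h, sub_zero]
  · rw [if_pos h, h, sub_self]

end EulerDerivation

section IntegrallyClosed

lemma isIntegrallyClosed_iff_dvd_of_scaleRoots {A : Type*} [CommRing A] [IsDomain A] :
    IsIntegrallyClosed A ↔ ∀ (p : A[X]) (a b : A), p.Monic → b ≠ 0 →
      (p.scaleRoots b).eval a = 0 → b ∣ a := by
  have hscale : ∀ (p : A[X]) (a b : A), b ≠ 0 →
      ((p.scaleRoots b).eval a = 0 ↔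
        p.eval₂ (algebraMap A (FractionRing A)) (algebraMap A _ a / algebraMap A _ b) = 0) := by
    intro p a b hb
    have hb' : algebraMap A (FractionRing A) b ≠ 0 := by simpa using hb
    have h := scaleRoots_eval₂_mul (p := p) (algebraMap A (FractionRing A))
      (algebraMap A _ a / algebraMap A _ b) b
    rw [mul_div_cancel₀ _ hb', eval₂_hom] at h
    rw [← map_eq_zero_iff _ (IsFractionRing.injective A (FractionRing A)), h, mul_eq_zero]
    simp [hb]
  constructor
  · intro h p a b hp hb hpa
    obtain ⟨c, hc⟩ := IsIntegrallyClosed.isIntegral_iff.mp ⟨p, hp, (hscale p a b hb).mp hpa⟩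
    have hb' : algebraMap A (FractionRing A) b ≠ 0 := by simpa using hb
    rw [eq_div_iff hb', ← map_mul] at hc
    exact ⟨c, by rw [mul_comm, IsFractionRing.injective A _ hc]⟩
  · intro h
    refine (isIntegrallyClosed_iff (FractionRing A)).mpr ?_
    rintro x ⟨p, hp, hpx⟩
    obtain ⟨a, b, hb, rfl⟩ := IsFractionRing.div_surjective (A := A) x
    obtain ⟨c, rfl⟩ := h p a b hp (nonZeroDivisors.ne_zero hb)
      ((hscale p a b (nonZeroDivisors.ne_zero hb)).mpr hpx)
    have hb' : algebraMap A (FractionRing A) b ≠ 0 := by simpa using hb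
    exact ⟨c, by rw [map_mul, mul_div_cancel_left₀ _ hb']⟩

variable {F : Type*} [Field F]

lemma isIntegrallyClosed_laurentPolynomial : IsIntegrallyClosed (AddMonoidAlgebra F ℤ) := by
  have : IsLocalization.Away (X : F[X]) (AddMonoidAlgebra F ℤ) := LaurentPolynomial.isLocalization
  exact isIntegrallyClosed_of_isLocalization (AddMonoidAlgebra F ℤ) (Submonoid.powers (X : F[X]))
    (powers_le_nonZeroDivisors_of_noZeroDivisors X_ne_zero)

/-- The inclusion of Laurent polynomials in the `e`-th root of the variable. -/
noncomputable def laurentRoot (F : Type*) [Field F] (e : ℕ) :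
    AddMonoidAlgebra F ℤ →+* AddMonoidAlgebra F ℚ :=
  AddMonoidAlgebra.mapDomainRingHom F
    ((AddMonoidHom.mulRight (e : ℚ)⁻¹).comp (Int.castAddHom ℚ))

lemma laurentRoot_injective {e : ℕ} (he : e ≠ 0) : Function.Injective (laurentRoot F e) :=
  AddMonoidAlgebra.mapDomain_injective fun a b h => by
    have he' : (e : ℚ) ≠ 0 := Nat.cast_ne_zero.mpr he
    simpa [he'] using h

lemma exists_laurentRoot_range (T : Finset (AddMonoidAlgebra F ℚ)) :
    ∃ e : ℕ, e ≠ 0 ∧ ∀ p ∈ T, p ∈ (laurentRoot F e).range := by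
  classical
  let e := ∏ q ∈ T.biUnion fun p => p.coeff.support, q.den
  refine ⟨e, Finset.prod_ne_zero_iff.mpr fun q _ => q.den_nz, fun p hp => ?_⟩
  have hmem : ∀ q ∈ p.coeff.support, ∃ m : ℤ, (m : ℚ) * (e : ℚ)⁻¹ = q := by
    intro q hq
    obtain ⟨c, hc⟩ : q.den ∣ e :=
      Finset.dvd_prod_of_mem _ (Finset.mem_biUnion.mpr ⟨p, hp, hq⟩)
    have he : (e : ℚ) ≠ 0 := Nat.cast_ne_zero.mpr
      (Finset.prod_ne_zero_iff.mpr fun q _ => q.den_nz)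
    refine ⟨q.num * c, ?_⟩
    rw [mul_inv_eq_iff_eq_mul₀ he, hc]
    push_cast
    rw [← mul_assoc, Rat.mul_den_eq_num]
  have hsum : p = ∑ q ∈ p.coeff.support, AddMonoidAlgebra.single q (p.coeff q) := by
    apply AddMonoidAlgebra.coeff_injective
    rw [AddMonoidAlgebra.coeff_sum]
    exact (Finsupp.sum_single p.coeff).symm
  rw [hsum]
  refine sum_mem fun q hq => ?_
  obtain ⟨m, hm⟩ := hmem q hq
  refine ⟨.single m (p.coeff q), ?_⟩
  rw [← hm]
  exact AddMonoidAlgebra.mapDomain_single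

instance isIntegrallyClosed_groupAlgebra_rat : IsIntegrallyClosed (AddMonoidAlgebra F ℚ) := by
  classical
  rw [isIntegrallyClosed_iff_dvd_of_scaleRoots]
  intro p a b hp hb hpa
  obtain ⟨e, he, hT⟩ := exists_laurentRoot_range (insert a (insert b p.coeffs))
  obtain ⟨a', ha⟩ := hT a (by simp)
  obtain ⟨b', hb'⟩ := hT b (by simp)
  have hl : p ∈ lifts (laurentRoot F e) := by
    refine (lifts_iff_coeff_lifts p).mpr fun i => ?_
    by_cases h0 : p.coeff i = 0
    · exact ⟨0, by rw [map_zero, h0]⟩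
    · exact hT _ (by simp [coeff_mem_coeffs h0])
  obtain ⟨p', hp', -, hp'm⟩ := lifts_and_natDegree_eq_and_monic hl hp
  have hmap : (p'.scaleRoots b').map (laurentRoot F e) = p.scaleRoots b := by
    rw [map_scaleRoots _ _ _ (by rw [hp'm.leadingCoeff, map_one]; exact one_ne_zero), hp', hb']
  subst ha hb'
  obtain ⟨c, rfl⟩ := isIntegrallyClosed_iff_dvd_of_scaleRoots.mp
    isIntegrallyClosed_laurentPolynomial p' a' b' hp'm (fun h => hb (by rw [h, map_zero]))
    (laurentRoot_injective he (by rw [map_zero, ← hpa, ← hmap, eval_map, eval₂_hom]))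
  exact ⟨_, map_mul _ _ _⟩

end IntegrallyClosed

section Ultrapower

/-- The ultrapower of `α` with respect to a nonprincipal ultrafilter on the natural numbers. -/
def Ultrapower (α : Type*) : Type _ := Filter.Germ (Filter.hyperfilter ℕ : Filter ℕ) α

namespace Ultrapower

variable {α β A B F : Type*}

noncomputable instance [CommRing A] : CommRing (Ultrapower A) :=
  inferInstanceAs (CommRing (Filter.Germ (Filter.hyperfilter ℕ : Filter ℕ) A))

noncomputable instance [Field F] : Field (Ultrapower F) :=
  inferInstanceAs (Field (Filter.Germ (Filter.hyperfilter ℕ : Filter ℕ) F))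

instance [Nontrivial α] : Nontrivial (Ultrapower α) :=
  inferInstanceAs (Nontrivial (Filter.Germ (Filter.hyperfilter ℕ : Filter ℕ) α))

noncomputable instance [LinearOrder α] : LinearOrder (Ultrapower α) :=
  inferInstanceAs (LinearOrder (Filter.Germ (Filter.hyperfilter ℕ : Filter ℕ) α))

instance [Field F] [LinearOrder F] [IsStrictOrderedRing F] :
    IsStrictOrderedRing (Ultrapower F) :=
  inferInstanceAs (IsStrictOrderedRing (Filter.Germ (Filter.hyperfilter ℕ : Filter ℕ) F))

/-- The class of a sequence. -/
noncomputable def mk (f : ℕ → α) : Ultrapower α := Filter.Germ.ofFun f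

lemma mk_surjective : Function.Surjective (mk : (ℕ → α) → Ultrapower α) := Quot.exists_rep

lemma mk_eq_mk {f g : ℕ → α} : mk f = mk g ↔ ∀ᶠ n in Filter.hyperfilter ℕ, f n = g n :=
  Filter.Germ.coe_eq

lemma mk_le_mk [LinearOrder α] {f g : ℕ → α} :
    mk f ≤ mk g ↔ ∀ᶠ n in Filter.hyperfilter ℕ, f n ≤ g n :=
  Filter.Germ.coe_le

lemma mk_lt_mk [LinearOrder α] {f g : ℕ → α} :
    mk f < mk g ↔ ∀ᶠ n in Filter.hyperfilter ℕ, f n < g n :=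
  Filter.Germ.coe_lt

lemma mk_ne_mk {f g : ℕ → α} : mk f ≠ mk g ↔ ∀ᶠ n in Filter.hyperfilter ℕ, f n ≠ g n := by
  rw [Ne, mk_eq_mk, ← Ultrafilter.eventually_not]

variable [CommRing A] [CommRing B]

/-- The class of a sequence, as a ring homomorphism. -/
noncomputable def mkHom (A : Type*) [CommRing A] : (ℕ → A) →+* Ultrapower A :=
  Filter.Germ.coeRingHom _

lemma mkHom_apply (f : ℕ → A) : mkHom A f = mk f := rfl

lemma mk_zero : mk (fun _ : ℕ => (0 : A)) = 0 := rfl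

lemma mk_add (f g : ℕ → A) : mk (fun n => f n + g n) = mk f + mk g := rfl

lemma mk_sub (f g : ℕ → A) : mk (fun n => f n - g n) = mk f - mk g := rfl

lemma mk_mul (f g : ℕ → A) : mk (fun n => f n * g n) = mk f * mk g := rfl

lemma mk_eq_zero {f : ℕ → A} : mk f = 0 ↔ ∀ᶠ n in Filter.hyperfilter ℕ, f n = 0 :=
  mk_eq_mk

lemma mk_ne_zero {f : ℕ → A} : mk f ≠ 0 ↔ ∀ᶠ n in Filter.hyperfilter ℕ, f n ≠ 0 :=
  mk_ne_mk

/-- The map induced on ultrapowers. -/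
noncomputable def map (φ : α → β) : Ultrapower α → Ultrapower β := Filter.Germ.map φ

lemma map_mk (φ : α → β) (f : ℕ → α) : map φ (mk f) = mk fun n => φ (f n) := rfl

/-- The ring homomorphism induced on ultrapowers. -/
noncomputable def mapHom (φ : A →+* B) : Ultrapower A →+* Ultrapower B where
  toFun := map φ
  map_zero' := congrArg mk (funext fun _ => map_zero φ)
  map_one' := congrArg mk (funext fun _ => map_one φ)
  map_add' x y := by
    obtain ⟨f, rfl⟩ := mk_surjective x
    obtain ⟨g, rfl⟩ := mk_surjective y
    exact congrArg mk (funext fun _ => map_add φ _ _)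
  map_mul' x y := by
    obtain ⟨f, rfl⟩ := mk_surjective x
    obtain ⟨g, rfl⟩ := mk_surjective y
    exact congrArg mk (funext fun _ => map_mul φ _ _)

lemma mapHom_injective {φ : A →+* B} (hφ : Function.Injective φ) :
    Function.Injective (mapHom φ) := by
  intro x y h
  obtain ⟨f, rfl⟩ := mk_surjective x
  obtain ⟨g, rfl⟩ := mk_surjective y
  exact mk_eq_mk.mpr ((mk_eq_mk.mp h).mono fun n hn => hφ hn)

lemma exists_monic_lift [Nontrivial A] {p : (Ultrapower A)[X]} (hp : p.Monic) :
    ∃ P : (ℕ → A)[X], P.map (mkHom A) = p ∧ P.degree = p.degree ∧ P.Monic := by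
  have hl : p ∈ lifts (mkHom A) :=
    (lifts_iff_coeff_lifts p).mpr fun i => mk_surjective (p.coeff i)
  exact lifts_and_degree_eq_and_monic hl hp

lemma eval_mk (P : (ℕ → A)[X]) (f : ℕ → A) :
    (P.map (mkHom A)).eval (mk f) = mk fun n => (P.map (Pi.evalRingHom _ n)).eval (f n) := by
  rw [← mkHom_apply, eval_map, eval₂_hom, mkHom_apply]
  congr 1
  funext n
  rw [eval_map]
  exact (eval₂_hom (p := P) (Pi.evalRingHom (fun _ : ℕ => A) n) f).symm

instance [Field F] [IsAlgClosed F] : IsAlgClosed (Ultrapower F) := by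
  refine IsAlgClosed.of_exists_root _ fun p hp hirr => ?_
  obtain ⟨P, rfl, hdeg, hP⟩ := exists_monic_lift hp
  have hroot : ∀ n, ∃ x, (P.map (Pi.evalRingHom (fun _ : ℕ => F) n)).eval x = 0 := by
    intro n
    refine IsAlgClosed.exists_root _ ?_
    rw [hP.degree_map, hdeg]
    exact hirr.degree_pos.ne'
  choose x hx using hroot
  refine ⟨mk x, ?_⟩
  rw [eval_mk]
  exact congrArg mk (funext hx)

instance [IsDomain A] : IsDomain (Ultrapower A) := by
  have : NoZeroDivisors (Ultrapower A) := by
    refine ⟨fun {x y} h => ?_⟩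
    obtain ⟨f, rfl⟩ := mk_surjective x
    obtain ⟨g, rfl⟩ := mk_surjective y
    rw [mk_eq_zero, mk_eq_zero, ← Ultrafilter.eventually_or]
    exact (mk_eq_zero.mp h).mono fun n hn => mul_eq_zero.mp hn
  exact NoZeroDivisors.to_isDomain _

instance [IsDomain A] [IsIntegrallyClosed A] : IsIntegrallyClosed (Ultrapower A) := by
  rw [isIntegrallyClosed_iff_dvd_of_scaleRoots]
  intro p a b hp hb hpa
  obtain ⟨P, rfl, -, hP⟩ := exists_monic_lift hp
  obtain ⟨a, rfl⟩ := mk_surjective a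
  obtain ⟨b, rfl⟩ := mk_surjective b
  rw [← mkHom_apply b, ← map_scaleRoots _ _ _ (by
    rw [hP.leadingCoeff, map_one]; exact one_ne_zero), eval_mk, mk_eq_zero] at hpa
  have hdvd : ∀ᶠ n in Filter.hyperfilter ℕ, b n ∣ a n := by
    filter_upwards [hpa, mk_ne_zero.mp hb] with n h₁ h₂
    rw [map_scaleRoots _ _ _ (by rw [hP.leadingCoeff, map_one]; exact one_ne_zero)] at h₁
    exact isIntegrallyClosed_iff_dvd_of_scaleRoots.mp inferInstance _ _ _ (hP.map _) h₂ h₁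
  have hex : ∀ n, ∃ c, b n ∣ a n → a n = b n * c := fun n => by
    by_cases h : b n ∣ a n
    · exact ⟨h.choose, fun _ => h.choose_spec⟩
    · exact ⟨0, fun h' => absurd h' h⟩
  choose c hc using hex
  exact ⟨mk c, mk_eq_mk.mpr (hdvd.mono hc)⟩

end Ultrapower

end Ultrapower

section UltrapowerSparseModel

section Inclusion

variable {Γ : Type*} [AddCommGroup Γ] [LinearOrder Γ] [IsOrderedAddMonoid Γ]

variable (Γ) in
/-- The inclusion of the group algebra in Hahn series, as a ring homomorphism. -/
noncomputable def toHahnRingHom (F : Type*) [Field F] :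
    AddMonoidAlgebra F Γ →+* HahnSeries Γ F := (toHahn Γ F).toRingHom

lemma toHahn_algebraMap {F : Type*} [Field F] (c : F) :
    toHahn Γ F (algebraMap F _ c) = HahnSeries.C c := (toHahn Γ F).commutes c

end Inclusion

namespace Ultrapower

variable {F : Type*} [Field F]

instance [CharZero F] : CharZero (Ultrapower F) := by
  refine ⟨fun m n h => ?_⟩
  rw [← map_natCast (mkHom F) m, ← map_natCast (mkHom F) n, mkHom_apply, mkHom_apply,
    mk_eq_mk] at h
  obtain ⟨k, hk⟩ := h.exists
  exact Nat.cast_injective hk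

noncomputable instance : Algebra (Ultrapower F) (Ultrapower (AddMonoidAlgebra F ℚ)) :=
  (mapHom (algebraMap F _)).toAlgebra

noncomputable instance : Algebra (Ultrapower F) (Ultrapower (HahnSeries ℚ F)) :=
  (mapHom HahnSeries.C).toAlgebra

noncomputable instance :
    Algebra (Ultrapower (AddMonoidAlgebra F ℚ)) (Ultrapower (HahnSeries ℚ F)) :=
  (mapHom (toHahnRingHom ℚ F)).toAlgebra

lemma algebraMap_hahn_mk (c : ℕ → F) :
    algebraMap (Ultrapower F) (Ultrapower (HahnSeries ℚ F)) (mk c) =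
      mk fun n => HahnSeries.C (c n) := rfl

instance : IsScalarTower (Ultrapower F) (Ultrapower (AddMonoidAlgebra F ℚ))
    (Ultrapower (HahnSeries ℚ F)) := by
  refine IsScalarTower.of_algebraMap_eq fun x => ?_
  obtain ⟨c, rfl⟩ := mk_surjective x
  exact congrArg mk (funext fun n => (toHahn_algebraMap (c n)).symm)

open Classical in
/-- The order of an element of the ultrapower of the field of Hahn series. -/
noncomputable def hahnOrder (x : Ultrapower (HahnSeries ℚ F)) : WithTop (Ultrapower ℚ) :=
  if x = 0 then ⊤ else (map HahnSeries.order x : Ultrapower ℚ)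

lemma coe_le_hahnOrder_mk {a : ℕ → ℚ} {x : ℕ → HahnSeries ℚ F} :
    (mk a : Ultrapower ℚ) ≤ hahnOrder (mk x) ↔
      ∀ᶠ n in Filter.hyperfilter ℕ, x n ≠ 0 → a n ≤ (x n).order := by
  unfold hahnOrder
  split_ifs with h
  · simp only [le_top, true_iff]
    exact (mk_eq_zero.mp h).mono fun n hn h => absurd hn h
  · rw [WithTop.coe_le_coe, map_mk, mk_le_mk]
    exact ⟨fun h' => h'.mono fun n hn _ => hn,
      fun h' => (h'.and (mk_ne_zero.mp h)).mono fun n hn => hn.1 hn.2⟩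

lemma coe_lt_hahnOrder_mk {a : ℕ → ℚ} {x : ℕ → HahnSeries ℚ F} :
    (mk a : Ultrapower ℚ) < hahnOrder (mk x) ↔
      ∀ᶠ n in Filter.hyperfilter ℕ, x n ≠ 0 → a n < (x n).order := by
  unfold hahnOrder
  split_ifs with h
  · simp only [WithTop.coe_lt_top, true_iff]
    exact (mk_eq_zero.mp h).mono fun n hn h => absurd hn h
  · rw [WithTop.coe_lt_coe, map_mk, mk_lt_mk]
    exact ⟨fun h' => h'.mono fun n hn _ => hn,
      fun h' => (h'.and (mk_ne_zero.mp h)).mono fun n hn => hn.1 hn.2⟩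

lemma hahnOrder_mk {x : ℕ → HahnSeries ℚ F} (hx : mk x ≠ 0) :
    hahnOrder (mk x) = (mk fun n => (x n).order : Ultrapower ℚ) := if_neg hx

lemma hahnOrder_zero : hahnOrder (0 : Ultrapower (HahnSeries ℚ F)) = ⊤ := if_pos rfl

lemma hahnOrder_le_hahnOrder_mk {x y : ℕ → HahnSeries ℚ F}
    (h : ∀ n, y n ≠ 0 → x n ≠ 0 ∧ (x n).order ≤ (y n).order) :
    hahnOrder (mk x) ≤ hahnOrder (mk y) := by
  by_cases hx : mk x = 0
  · have hy : mk y = 0 := mk_eq_zero.mpr ((mk_eq_zero.mp hx).mono fun n hn => by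
      by_contra h'
      exact (h n h').1 hn)
    rw [hx, hy]
  · rw [hahnOrder_mk hx, coe_le_hahnOrder_mk]
    exact .of_forall fun n hn => (h n hn).2

/-- The order on the ultrapower of the field of Hahn series, as a valuation. -/
noncomputable def hahnValuation :
    AddValuation (Ultrapower (HahnSeries ℚ F)) (WithTop (Ultrapower ℚ)) :=
  AddValuation.of hahnOrder hahnOrder_zero
    ((hahnOrder_mk (x := fun _ => 1) one_ne_zero).trans
      (congrArg _ (congrArg mk (funext fun _ => HahnSeries.order_one))))
    (fun x y => by
      by_cases hx0 : x = 0
      · rw [hx0, zero_add]; exact min_le_right _ _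
      by_cases hy0 : y = 0
      · rw [hy0, add_zero]; exact min_le_left _ _
      obtain ⟨f, rfl⟩ := mk_surjective x
      obtain ⟨g, rfl⟩ := mk_surjective y
      rw [← mk_add]
      rcases le_total (hahnOrder (mk f)) (hahnOrder (mk g)) with h | h
      · rw [min_eq_left h]
        rw [hahnOrder_mk hx0] at h ⊢
        rw [coe_le_hahnOrder_mk] at h ⊢
        filter_upwards [h, mk_ne_zero.mp hy0] with n h₁ h₂ h₃
        exact (le_min le_rfl (h₁ h₂)).trans (HahnSeries.min_order_le_order_add h₃)
      · rw [min_eq_right h]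
        rw [hahnOrder_mk hy0] at h ⊢
        rw [coe_le_hahnOrder_mk] at h ⊢
        filter_upwards [h, mk_ne_zero.mp hx0] with n h₁ h₂ h₃
        exact (le_min (h₁ h₂) le_rfl).trans (HahnSeries.min_order_le_order_add h₃))
    (fun x y => by
      by_cases hx0 : x = 0
      · rw [hx0, zero_mul, hahnOrder_zero, top_add]
      by_cases hy0 : y = 0
      · rw [hy0, mul_zero, hahnOrder_zero, add_top]
      have hxy := mul_ne_zero hx0 hy0
      obtain ⟨f, rfl⟩ := mk_surjective x
      obtain ⟨g, rfl⟩ := mk_surjective y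
      rw [← mk_mul] at hxy ⊢
      rw [hahnOrder_mk hxy, hahnOrder_mk hx0, hahnOrder_mk hy0, ← WithTop.coe_add, ← mk_add,
        WithTop.coe_inj, mk_eq_mk]
      filter_upwards [mk_ne_zero.mp hx0, mk_ne_zero.mp hy0] with n h₁ h₂
      exact HahnSeries.order_mul h₁ h₂)

lemma hahnValuation_apply (x : Ultrapower (HahnSeries ℚ F)) : hahnValuation x = hahnOrder x :=
  rfl

/-- The monomials of the ultrapower of the group algebra. -/
noncomputable def groupAlgebraMono :
    Multiplicative (Ultrapower ℚ) →* Ultrapower (AddMonoidAlgebra F ℚ) where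
  toFun γ := map (fun q => AddMonoidAlgebra.single q 1) γ.toAdd
  map_one' := rfl
  map_mul' x y := by
    obtain ⟨f, hf⟩ := mk_surjective x.toAdd
    obtain ⟨g, hg⟩ := mk_surjective y.toAdd
    rw [toAdd_mul, ← hf, ← hg]
    exact congrArg mk (funext fun n => by simp [AddMonoidAlgebra.single_mul_single])

lemma toHahn_groupAlgebraMono_mk (q : ℕ → ℚ) :
    algebraMap _ (Ultrapower (HahnSeries ℚ F)) (groupAlgebraMono (F := F) (.ofAdd (mk q))) =
      mk fun n => HahnSeries.single (q n) 1 :=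
  congrArg mk (funext fun _ => toHahn_single _ _)

lemma smul_hahn_mk (c : ℕ → F) (x : ℕ → HahnSeries ℚ F) :
    mk c • mk x = mk fun n => HahnSeries.C (c n) * x n := rfl

/-- The Euler derivation of the ultrapower of the field of Hahn series. -/
noncomputable def hahnDerivation [CharZero F] :
    Derivation (Ultrapower F) (Ultrapower (HahnSeries ℚ F)) (Ultrapower (HahnSeries ℚ F)) :=
  Derivation.mk'
    { toFun := map hahnEuler
      map_add' := fun x y => by
        obtain ⟨f, rfl⟩ := mk_surjective x
        obtain ⟨g, rfl⟩ := mk_surjective y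
        exact congrArg mk (funext fun n => hahnEuler_add _ _)
      map_smul' := fun x y => by
        obtain ⟨c, rfl⟩ := mk_surjective x
        obtain ⟨f, rfl⟩ := mk_surjective y
        rw [smul_hahn_mk, map_mk, map_mk, RingHom.id_apply, smul_hahn_mk]
        refine congrArg mk (funext fun n => ?_)
        rw [hahnEuler_mul, HahnSeries.C_apply, hahnEuler_single]
        simp }
    fun x y => by
      obtain ⟨f, rfl⟩ := mk_surjective x
      obtain ⟨g, rfl⟩ := mk_surjective y
      exact congrArg mk (funext fun n => hahnEuler_mul _ _)

lemma hahnDerivation_mk [CharZero F] (x : ℕ → HahnSeries ℚ F) :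
    hahnDerivation (mk x) = mk fun n => hahnEuler (x n) := rfl

variable (F) in
/-- The ultrapower of the group algebra inside the ultrapower of the field of Hahn series. -/
noncomputable def sparseModel [CharZero F] : SparseModel (Ultrapower ℚ) (Ultrapower F)
    (Ultrapower (AddMonoidAlgebra F ℚ)) (Ultrapower (HahnSeries ℚ F)) where
  ord := hahnValuation
  mono := groupAlgebraMono
  flip :=
    { mapHom (groupAlgebraFlip F).toRingHom with
      commutes' := fun x => by
        obtain ⟨c, rfl⟩ := mk_surjective x
        exact congrArg mk (funext fun n => (groupAlgebraFlip F).commutes (c n)) }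
  θ := hahnDerivation
  κ := mapHom (Rat.castHom F)
  κ_injective := mapHom_injective Rat.cast_injective
  algebraMap_injective := mapHom_injective (toHahn_injective (Γ := ℚ) (F := F))
  ord_mono γ := by
    obtain ⟨q, rfl⟩ := mk_surjective γ
    rw [toHahn_groupAlgebraMono_mk, hahnValuation_apply, hahnOrder_mk]
    · simp
    · exact mk_ne_zero.mpr (.of_forall fun n => by simp)
  ord_algebraMap c hc := by
    have h := (algebraMap (Ultrapower F) (Ultrapower (HahnSeries ℚ F))).injective.ne hc
    rw [map_zero] at h
    obtain ⟨c, rfl⟩ := mk_surjective c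
    rw [algebraMap_hahn_mk] at h ⊢
    rw [hahnValuation_apply, hahnOrder_mk h]
    exact congrArg _ (congrArg mk (funext fun n => HahnSeries.order_C))
  flip_mono γ := by
    obtain ⟨q, rfl⟩ := mk_surjective γ
    exact congrArg mk (funext fun n => AddMonoidAlgebra.mapDomain_single)
  θ_mono γ := by
    obtain ⟨q, rfl⟩ := mk_surjective γ
    rw [toHahn_groupAlgebraMono_mk, hahnDerivation_mk]
    refine congrArg mk (funext fun n => (hahnEuler_single _ _).trans ?_)
    change _ = HahnSeries.C (q n : F) * HahnSeries.single (q n) 1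
    rw [HahnSeries.C_apply, HahnSeries.single_mul_single, zero_add]
  ord_le_ord_θ x := by
    obtain ⟨f, rfl⟩ := mk_surjective x
    refine hahnOrder_le_hahnOrder_mk fun n hn => ⟨fun h => hn ?_, ?_⟩
    · ext q
      simp [h]
    · exact HahnSeries.order_le_order_of_support_subset (fun q hq => by simp [hq]) hn
  exists_leading x hx := by
    obtain ⟨f, rfl⟩ := mk_surjective x
    refine ⟨mk fun n => (f n).coeff (f n).order, mk fun n => (f n).order, ?_, hahnOrder_mk hx, ?_⟩
    · rw [mk_ne_zero]
      filter_upwards [mk_ne_zero.mp hx] with n hn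
      exact HahnSeries.coeff_order_eq_zero.not.mpr hn
    · rw [toHahn_groupAlgebraMono_mk, smul_hahn_mk, ← mk_sub, hahnValuation_apply,
        coe_lt_hahnOrder_mk]
      refine .of_forall fun n hn => ?_
      simp only [HahnSeries.C_apply, HahnSeries.single_mul_single, zero_add, mul_one] at hn ⊢
      exact HahnSeries.order_lt_order_sub_single hn
  exists_θ p := by
    obtain ⟨f, rfl⟩ := mk_surjective p
    have hcoeff : ∀ n q, (toHahn ℚ F (groupAlgebraFlip F (f n))).coeff q = 0 →
        (toHahn ℚ F (groupAlgebraFlip F (groupAlgebraEuler (f n)))).coeff q = 0 := by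
      intro n q h
      rw [coeff_toHahn, coeff_groupAlgebraFlip, ← coeff_toHahn] at h ⊢
      rw [toHahn_groupAlgebraEuler, coeff_hahnEuler, h, mul_zero]
    refine ⟨mk fun n => groupAlgebraEuler (f n),
      congrArg mk (funext fun n => toHahn_groupAlgebraEuler _),
      hahnOrder_le_hahnOrder_mk fun n hn => ⟨fun h => hn ?_, ?_⟩⟩
    · exact HahnSeries.ext (funext fun q => hcoeff n q (congrArg (fun x => x.coeff q) h))
    · exact HahnSeries.order_le_order_of_support_subset (hcoeff n) hn
  ord_add_ord_flip_nonpos p hp := by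
    obtain ⟨f, rfl⟩ := mk_surjective p
    rw [mk_ne_zero] at hp
    have hflip : ∀ p : AddMonoidAlgebra F ℚ, p ≠ 0 → groupAlgebraFlip F p ≠ 0 := fun p hp h =>
      hp (AddMonoidAlgebra.coeff_injective (Finsupp.ext fun q => by
        rw [← neg_neg q, ← coeff_groupAlgebraFlip, h]; rfl))
    have htoHahn : ∀ p : AddMonoidAlgebra F ℚ, p ≠ 0 → toHahn ℚ F p ≠ 0 := fun p hp =>
      (map_ne_zero_iff _ toHahn_injective).mpr hp
    have h₁ := hahnOrder_mk (mk_ne_zero.mpr (hp.mono fun n hn => htoHahn _ hn))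
    have h₂ := hahnOrder_mk (mk_ne_zero.mpr (hp.mono fun n hn => htoHahn _ (hflip _ hn)))
    refine (congrArg₂ (· + ·) h₁ h₂).trans_le ?_
    rw [← WithTop.coe_add, ← WithTop.coe_zero, WithTop.coe_le_coe, ← mk_add, ← mk_zero,
      mk_le_mk]
    exact hp.mono fun n hn => order_toHahn_add_order_flip_nonpos hn

end Ultrapower

end UltrapowerSparseModel

section Bound

namespace Ultrapower

variable {F : Type*} [Field F]

open scoped Pointwise in
lemma exists_card_support_le_of_mem_laurent [CharZero F] {Γ : Submodule ℚ (Ultrapower ℚ)}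
    {p : ℕ → AddMonoidAlgebra F ℚ} (hp : mk p ∈ (sparseModel F).laurent Γ) :
    ∃ k : ℕ, ∀ᶠ n in Filter.hyperfilter ℕ, (p n).coeff.support.card ≤ k := by
  classical
  suffices ∃ (k : ℕ) (q : ℕ → AddMonoidAlgebra F ℚ), mk q = mk p ∧
      ∀ n, (q n).coeff.support.card ≤ k by
    obtain ⟨k, q, hq, hk⟩ := this
    exact ⟨k, (mk_eq_mk.mp hq).mono fun n hn => hn ▸ hk n⟩
  have hsingle : ∀ (q : ℚ) (c : F),
      (AddMonoidAlgebra.single q c).coeff.support.card ≤ 1 := fun q c =>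
    (Finset.card_le_card Finsupp.support_single_subset).trans (Finset.card_singleton q).le
  generalize mk p = x at hp ⊢
  induction hp using Algebra.adjoin_induction with
  | mem x hx =>
    obtain ⟨γ, -, rfl⟩ := hx
    obtain ⟨q, rfl⟩ := mk_surjective γ
    exact ⟨1, _, rfl, fun n => hsingle _ _⟩
  | algebraMap c =>
    obtain ⟨c, rfl⟩ := mk_surjective c
    exact ⟨1, _, rfl, fun n => hsingle _ _⟩
  | add x y _ _ hx hy =>
    obtain ⟨k, q, rfl, hk⟩ := hx
    obtain ⟨l, r, rfl, hl⟩ := hy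
    exact ⟨k + l, _, rfl, fun n => (Finset.card_le_card Finsupp.support_add).trans
      ((Finset.card_union_le _ _).trans (add_le_add (hk n) (hl n)))⟩
  | mul x y _ _ hx hy =>
    obtain ⟨k, q, rfl, hk⟩ := hx
    obtain ⟨l, r, rfl, hl⟩ := hy
    exact ⟨k * l, _, rfl, fun n =>
      (Finset.card_le_card (AddMonoidAlgebra.support_coeff_mul_subset _ _)).trans
        (Finset.card_add_le.trans (Nat.mul_le_mul (hk n) (hl n)))⟩

end Ultrapower

variable {F : Type*} [Field F]

variable (F) in
/-- The inclusion of polynomials in the group algebra of the rational numbers. -/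
noncomputable def polynomialToGroupAlgebra : F[X] →+* AddMonoidAlgebra F ℚ :=
  (AddMonoidAlgebra.mapDomainRingHom F (Nat.castAddMonoidHom ℚ)).comp
    (toFinsuppIso F : F[X] →+* AddMonoidAlgebra F ℕ)

lemma polynomialToGroupAlgebra_monomial (n : ℕ) (c : F) :
    polynomialToGroupAlgebra F (monomial n c) = AddMonoidAlgebra.single (n : ℚ) c :=
  (congrArg _ (toFinsupp_monomial n c)).trans AddMonoidAlgebra.mapDomain_single

lemma card_support_polynomialToGroupAlgebra (p : F[X]) :
    (polynomialToGroupAlgebra F p).coeff.support.card = p.support.card := by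
  classical
  rw [← support_toFinsupp]
  exact (congrArg _ (Finsupp.mapDomain_support_of_injective Nat.cast_injective _)).trans
    (Finset.card_image_of_injective _ Nat.cast_injective)

lemma exists_eq_sum_monomial {s : Finset ℕ} {ℓ : ℕ} {e : Fin ℓ → ℕ} (he : ∀ x ∈ s, ∃ i, e i = x)
    {p : F[X]} (hp : p.support ⊆ s) : ∃ c : Fin ℓ → F, ∑ i, monomial (e i) (c i) = p := by
  have hmem : p ∈ Submodule.span F (Set.range fun i => monomial (e i) (1 : F)) := by
    rw [p.as_sum_support]
    refine sum_mem fun x hx => ?_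
    obtain ⟨i, rfl⟩ := he x (hp hx)
    rw [← mul_one (p.coeff (e i)), ← smul_eq_mul, ← smul_monomial]
    exact Submodule.smul_mem _ _ (Submodule.subset_span ⟨i, rfl⟩)
  obtain ⟨c, hc⟩ := (Submodule.mem_span_range_iff_exists_fun F).mp hmem
  exact ⟨c, by simpa [smul_monomial] using hc⟩

lemma Finset.exists_fin_fun_of_card_le {s : Finset ℕ} {ℓ : ℕ} (hs : s.card ≤ ℓ) :
    ∃ e : Fin ℓ → ℕ, ∀ x ∈ s, ∃ i, e i = x := by
  refine ⟨fun i => s.toList.getD i 0, fun x hx => ?_⟩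
  obtain ⟨i, hi, rfl⟩ := List.mem_iff_getElem.mp (Finset.mem_toList.mpr hx)
  rw [Finset.length_toList] at hi
  exact ⟨⟨i, hi.trans_le hs⟩, by simp [hi]⟩

lemma exists_card_support_le [IsAlgClosed F] [CharZero F] (d ℓ : ℕ) :
    ∃ B : ℕ, ∀ (f : F[X][X]) (G : F[X]), f.Monic → f.natDegree = d →
      (f.support.biUnion fun j => (f.coeff j).support).card ≤ ℓ → f.eval G = 0 →
      G.support.card ≤ B := by
  by_contra! hcon
  choose f G hmonic hdeg hcard heval hlarge using hcon
  choose e he using fun n => Finset.exists_fin_fun_of_card_le (hcard n)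
  have hsupp : ∀ n j, ((f n).coeff j).support ⊆
      (f n).support.biUnion fun j => ((f n).coeff j).support := by
    intro n j x hx
    refine Finset.mem_biUnion.mpr ⟨j, mem_support_iff.mpr fun h => ?_, hx⟩
    simp [h] at hx
  choose c hc using fun n j => exists_eq_sum_monomial (he n) (hsupp n j)
  let ι := polynomialToGroupAlgebra F
  let S := Ultrapower.sparseModel F
  let ε : Fin ℓ → Ultrapower ℚ := fun i => Ultrapower.mk fun n => (e n i : ℚ)
  let Γ : Submodule ℚ (Ultrapower ℚ) := Submodule.span ℚ (Set.range ε)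
  have : FiniteDimensional ℚ Γ := FiniteDimensional.span_of_finite ℚ (Set.finite_range _)
  have hcoeff : ∀ j, Ultrapower.mk (fun n => ι ((f n).coeff j)) ∈ S.laurent Γ := by
    intro j
    have : Ultrapower.mk (fun n => ι ((f n).coeff j)) =
        ∑ i, algebraMap (Ultrapower F) _ (Ultrapower.mk fun n => c n j i) *
          S.mono (.ofAdd (ε i)) := by
      change Ultrapower.mkHom _ _ = ∑ i, Ultrapower.mkHom (AddMonoidAlgebra F ℚ) (fun n =>
        algebraMap F _ (c n j i) * AddMonoidAlgebra.single (e n i : ℚ) 1)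
      rw [← map_sum]
      congr 1
      funext n
      rw [Finset.sum_apply, ← hc n j, map_sum]
      refine Finset.sum_congr rfl fun i _ => (polynomialToGroupAlgebra_monomial _ _).trans ?_
      simp [AddMonoidAlgebra.single_mul_single]
    rw [this]
    exact sum_mem fun i _ => mul_mem (Subalgebra.algebraMap_mem _ _)
      (S.mono_mem_laurent (Submodule.subset_span ⟨i, rfl⟩))
  have hinteg : IsIntegral (S.laurent Γ) (Ultrapower.mk fun n => ι (G n)) := by
    let a : ℕ → ℕ → AddMonoidAlgebra F ℚ := fun j n => ι ((f n).coeff j)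
    let p : (Ultrapower (AddMonoidAlgebra F ℚ))[X] :=
      X ^ d + ∑ j ∈ Finset.range d, C (Ultrapower.mk (a j)) * X ^ j
    refine RingHom.isIntegralElem_of_coeff_mem _ (p := p) ?_ ?_ ?_
    · refine monic_X_pow_add ?_
      exact (degree_sum_fin_lt fun j : Fin d => Ultrapower.mk (a j)).trans_eq' (by
        rw [Finset.sum_range])
    · intro i
      have hp : p.coeff i ∈ S.laurent Γ := by
        simp only [p, coeff_add, coeff_X_pow, finsetSum_coeff, coeff_C_mul]
        refine add_mem ?_ (sum_mem fun j _ => mul_mem (hcoeff j) ?_)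
        all_goals split_ifs; exacts [one_mem _, zero_mem _]
      exact ⟨⟨_, hp⟩, rfl⟩
    · have h : (fun n => ι (G n)) ^ d + ∑ j ∈ Finset.range d, a j * (fun n => ι (G n)) ^ j = 0 := by
        funext n
        have := congrArg ι (heval n)
        rw [eval_eq_sum_range, hdeg, Finset.sum_range_succ, ← hdeg n,
          (hmonic n).coeff_natDegree] at this
        simpa [a, add_comm, hdeg] using this
      have := congrArg (Ultrapower.mkHom _) h
      simp only [map_add, map_sum, map_mul, map_pow, map_zero, Ultrapower.mkHom_apply] at this
      simpa [p, eval_finsetSum] using this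
  obtain ⟨k, hk⟩ := Ultrapower.exists_card_support_le_of_mem_laurent
    (S.mem_laurent_top_of_isIntegral Γ hinteg)
  have hk' := (Filter.eventually_gt_atTop k).filter_mono Nat.hyperfilter_le_atTop
  obtain ⟨n, hn, hn'⟩ := (hk.and hk').exists
  rw [card_support_polynomialToGroupAlgebra] at hn
  exact absurd (hlarge n) (by omega)

end Bound
/-- Theorem 2(b) (Fuchs–Mantova–Zannier).  Here `f ∈ ℂ[x,y]` is encoded as a
polynomial in `y` with coefficients in `ℂ[x]`, i.e. as an element of
`(ℂ[x])[y]`: `f.Monic` says `f` is monic as a polynomial in `y`, `f.natDegree`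
is its degree in `y`, and the union of the supports of its coefficients is the
set of exponents of `x` occurring in `f`, whose cardinality is the number of
nonzero coefficients of `f` written as a polynomial in `x` over `ℂ[y]`.
The substitution `f(x, g(x))` maps `y ↦ g` and the coefficients
`c(x) ↦ c(X)`. -/
theorem fuchs_mantova_zannier_thm2b :
    ∃ B₅ : ℕ × ℕ → ℕ, ∀ (d ℓ : ℕ) (f : Polynomial (Polynomial ℂ)) (g : RatFunc ℂ),
      f.Monic →
      (f.support.biUnion fun j => (f.coeff j).support).card ≤ ℓ →
      f.natDegree ≤ d →
      Polynomial.eval₂ (Polynomial.eval₂RingHom RatFunc.C RatFunc.X) g f = 0 →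
      ∃ G : Polynomial ℂ, g = algebraMap (Polynomial ℂ) (RatFunc ℂ) G ∧
        G.support.card ≤ B₅ (d, ℓ) := by
  choose B hB using exists_card_support_le (F := ℂ)
  refine ⟨fun m => ∑ i ∈ Finset.range (m.1 + 1), B i m.2,
    fun d ℓ f g hf hcard hd hroot => ?_⟩
  have hhom : eval₂RingHom RatFunc.C RatFunc.X = algebraMap ℂ[X] (RatFunc ℂ) := by
    apply Polynomial.ringHom_ext <;> simp
  rw [hhom] at hroot
  obtain ⟨G, rfl⟩ := IsIntegrallyClosed.isIntegral_iff.mp ⟨f, hf, hroot⟩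
  rw [eval₂_hom, map_eq_zero_iff _ (IsFractionRing.injective ℂ[X] (RatFunc ℂ))] at hroot
  exact ⟨G, rfl, (hB _ ℓ f G hf rfl hcard hroot).trans
    (Finset.single_le_sum (f := fun i => B i ℓ) (fun _ _ => Nat.zero_le _)
      (Finset.mem_range.mpr (Nat.lt_succ_of_le hd)))⟩
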